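/- Let ℓ be a positive integer and let f, g ∈ ℂ[x] be polynomials. If the composition f(g(x)) has at most ℓ nonzero coefficients, i.e. N(f ∘ g) ≤ ℓ, then either g(x) = a·x^n + b for some a, b ∈ ℂ and some natural number n, or deg(f) ≤ ℓ(ℓ − 1). -/

import Mathlib

open Polynomial

theorem rootMultiplicity_lt_card_support {F : Type*} [Field F] [CharZero F] {z : F} (hz : z ≠ 0)
    (p : F[X]) (hp : p ≠ 0) : p.rootMultiplicity z < p.support.card := by
  induction hn : p.natDegree using Nat.strong_induction_on generalizing p with
  | _ n ih =>
    subst hn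
    by_cases h0 : p.coeff 0 = 0
    · obtain ⟨q, rfl⟩ := X_dvd_iff.mpr h0
      have hq : q ≠ 0 := right_ne_zero_of_mul hp
      have h1 := ih q.natDegree (by rw [natDegree_X_mul hq]; omega) q hq rfl
      have h2 : rootMultiplicity z (X : F[X]) = 0 :=
        rootMultiplicity_eq_zero (by simpa using hz)
      rw [rootMultiplicity_mul hp, h2, zero_add]
      refine h1.trans_le ?_
      rw [← Finset.card_map (addRightEmbedding 1)]
      refine Finset.card_le_card fun i hi => ?_
      obtain ⟨j, hj, rfl⟩ := Finset.mem_map.mp hi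
      simpa using hj
    · by_cases hr : p.IsRoot z
      · have hd : derivative p ≠ 0 := by
          intro hd
          rw [derivative_eq_zero] at hd
          have hc := eq_C_of_natDegree_eq_zero hd
          rw [hc, IsRoot, eval_C] at hr
          exact hp (by rw [hc, hr, C_0])
        have hdeg : (derivative p).natDegree < p.natDegree :=
          natDegree_derivative_lt fun h => hd (by
            rw [eq_C_of_natDegree_eq_zero h, derivative_C])
        have h1 := ih _ hdeg _ hd rfl
        rw [derivative_rootMultiplicity_of_root hr] at h1
        have h2 : (derivative p).support.card + 1 ≤ p.support.card := by
          have : (derivative p).support.map (addRightEmbedding 1) ⊆ p.support.erase 0 := by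
            intro i hi
            obtain ⟨j, hj, rfl⟩ := Finset.mem_map.mp hi
            simp only [mem_support_iff, coeff_derivative, ne_eq, mul_eq_zero, not_or] at hj
            simpa using hj.1
          have := Finset.card_le_card this
          rw [Finset.card_map, Finset.card_erase_of_mem (by simpa using h0)] at this
          have : 0 < p.support.card := Finset.card_pos.mpr ⟨0, by simpa using h0⟩
          omega
        omega
      · rw [rootMultiplicity_eq_zero hr]
        exact Finset.card_pos.mpr (by simpa using hp)

theorem exists_ne_zero_root_of_not_shifted_monomial {F : Type*} [Field F] [IsAlgClosed F]
    {g : F[X]} (hg : ¬ ∃ (a b : F) (n : ℕ), g = C a * X ^ n + C b) (c : F) :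
    ∃ z, z ≠ 0 ∧ g.eval z = c := by
  by_contra! H
  refine hg ⟨(g - C c).leadingCoeff, c, (g - C c).natDegree, ?_⟩
  have hs := IsAlgClosed.splits (g - C c)
  have hr : (g - C c).roots = Multiset.replicate (g - C c).natDegree 0 := by
    rw [hs.natDegree_eq_card_roots]
    refine Multiset.eq_replicate_card.mpr fun z hz => ?_
    by_contra hz0
    exact H z hz0 (by simpa [sub_eq_zero] using (mem_roots'.mp hz).2)
  have h := hs.eq_prod_roots
  rw [hr, Multiset.map_replicate, Multiset.prod_replicate, C_0, sub_zero] at h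
  rw [← h, sub_add_cancel]

theorem rootMultiplicity_lt_card_support_comp {F : Type*} [Field F] [CharZero F] [IsAlgClosed F]
    {f g : F[X]} (hg : ¬ ∃ (a b : F) (n : ℕ), g = C a * X ^ n + C b)
    (hfg : f.comp g ≠ 0) (c : F) : f.rootMultiplicity c < (f.comp g).support.card := by
  obtain ⟨z, hz, hgz⟩ := exists_ne_zero_root_of_not_shifted_monomial hg c
  refine lt_of_le_of_lt ?_ (rootMultiplicity_lt_card_support hz _ hfg)
  rw [le_rootMultiplicity_iff hfg]
  obtain ⟨q, hq⟩ := pow_rootMultiplicity_dvd f c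
  have h1 : (X - C z) ∣ g - C c := dvd_iff_isRoot.mpr (by simp [hgz])
  refine (pow_dvd_pow_of_dvd h1 _).trans ⟨q.comp g, ?_⟩
  conv_lhs => rw [hq]
  simp

theorem le_mul_pred_of_gap {S : Finset ℕ}
    (h : ∀ e ∈ S, S.card ≤ e → ∃ e' ∈ S, e' < e ∧ e < e' + S.card) :
    ∀ e ∈ S, e ≤ S.card * (S.card - 1) := by
  have key : ∀ e ∈ S, e ≤ (S.filter (· ≤ e)).card * (S.card - 1) := by
    intro e
    induction e using Nat.strong_induction_on with
    | _ e ih =>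
      intro he
      by_cases hle : S.card ≤ e
      · obtain ⟨e', he', hlt, hgap⟩ := h e he hle
        have h1 := ih e' hlt he'
        have h2 : (S.filter (· ≤ e')).card + 1 ≤ (S.filter (· ≤ e)).card := by
          rw [← Finset.card_insert_of_notMem (a := e) (by simp [hlt])]
          refine Finset.card_le_card fun i hi => ?_
          simp only [Finset.mem_insert, Finset.mem_filter] at hi ⊢
          rcases hi with rfl | ⟨hi, hi'⟩
          · exact ⟨he, le_rfl⟩
          · exact ⟨hi, by omega⟩
        have h3 := Nat.mul_le_mul_right (S.card - 1) h2
        rw [add_mul] at h3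
        omega
      · have : 0 < (S.filter (· ≤ e)).card := Finset.card_pos.mpr ⟨e, by simp [he]⟩
        have := Nat.mul_le_mul_right (S.card - 1) this
        omega
  exact fun e he => (key e he).trans
    (Nat.mul_le_mul_right _ (Finset.card_le_card (Finset.filter_subset _ _)))

/-- The operator `∏ e ∈ l, ((X + η) d/dX - e)`. -/
noncomputable def shiftedEulerOp {F : Type*} [Field F] (η : F) : List ℕ → F[X] →ₗ[F] F[X]
  | [] => LinearMap.id
  | e :: l => (LinearMap.mulLeft F (X + C η) ∘ₗ derivative - (e : F) • LinearMap.id) ∘ₗ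
      shiftedEulerOp η l

theorem shiftedEulerOp_cons {F : Type*} [Field F] (η : F) (e : ℕ) (l : List ℕ) (p : F[X]) :
    shiftedEulerOp η (e :: l) p =
      (X + C η) * derivative (shiftedEulerOp η l p) - (e : F) • shiftedEulerOp η l p := rfl

theorem shiftedEulerOp_pow {F : Type*} [Field F] {c η : F} (hc : c ≠ 0) (l : List ℕ) (k : ℕ) :
    shiftedEulerOp (η / c) l ((C c * X + C η) ^ k) =
      (l.map fun e : ℕ => (k : F) - e).prod • (C c * X + C η) ^ k := by
  induction l with
  | nil => simp [shiftedEulerOp]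
  | cons e l ih =>
    have h1 : (X + C (η / c)) * derivative ((C c * X + C η) ^ k) =
        (k : F) • (C c * X + C η) ^ k := by
      rcases k with _ | k
      · simp
      · have : C c * (X + C (η / c)) = C c * X + C η := by
          rw [mul_add, ← C_mul, mul_div_cancel₀ _ hc]
        rw [derivative_pow_succ, smul_eq_C_mul, pow_succ]
        simp only [derivative_add, derivative_mul, derivative_C, derivative_X]
        push_cast
        simp only [map_add, map_natCast, map_one]
        linear_combination ((k : F[X]) + 1) * (C c * X + C η) ^ k * this
    rw [shiftedEulerOp_cons, ih, derivative_smul, mul_smul_comm, h1]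
    simp only [List.map_cons, List.prod_cons, smul_smul, ← sub_smul]
    congr 1
    ring

theorem coeff_shiftedEulerOp {F : Type*} [Field F] (η : F) (m : ℕ) (l : List ℕ)
    (hl : l.length = m + 1) (p : F[X]) (j : ℕ)
    (h : ∀ i, j < i → i < j + m + 1 → p.coeff i = 0) :
    (shiftedEulerOp η l p).coeff j = (l.map fun e : ℕ => (j : F) - e).prod * p.coeff j +
      η ^ (m + 1) * ((j + 1).ascFactorial (m + 1) : ℕ) * p.coeff (j + m + 1) := by
  have hco : ∀ (q : F[X]) (i : ℕ), ((X + C η) * derivative q).coeff i =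
      i * q.coeff i + η * ((i + 1) * q.coeff (i + 1)) := by
    intro q i
    rw [add_mul, coeff_add, coeff_C_mul, coeff_derivative]
    rcases i with _ | i
    · simp [mul_comm]
    · rw [coeff_X_mul, coeff_derivative]; push_cast; ring
  induction m generalizing l j with
  | zero =>
    obtain ⟨e, rfl⟩ := List.length_eq_one_iff.mp hl
    rw [shiftedEulerOp_cons, coeff_sub, hco]
    simp [shiftedEulerOp, Nat.ascFactorial]
    ring
  | succ m ih =>
    obtain ⟨e, l, rfl⟩ := List.exists_cons_of_length_eq_add_one hl
    have hl' : l.length = m + 1 := by simpa using hl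
    rw [shiftedEulerOp_cons, coeff_sub, hco, coeff_smul, smul_eq_mul,
      ih l hl' j (fun i h1 h2 => h i h1 (by omega)),
      ih l hl' (j + 1) (fun i h1 h2 => h i (by omega) (by omega)),
      h (j + 1) (by omega) (by omega), h (j + m + 1) (by omega) (by omega)]
    have : (j + 1).ascFactorial (m + 1 + 1) = (j + 1) * (j + 1 + 1).ascFactorial (m + 1) := by
      rw [Nat.ascFactorial_succ, ← Nat.succ_ascFactorial]
    rw [this, show j + 1 + m + 1 = j + (m + 1) + 1 by ring]
    simp only [List.map_cons, List.prod_cons]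
    push_cast
    ring

theorem natDegree_le_of_comp_linear_eq {F : Type*} [Field F] [CharZero F] {p : F[X]} {c η : F}
    (hc : c ≠ 0) (hη : η ≠ 0) (h : p.comp (C c * X + C η) = p) :
    p.natDegree ≤ p.support.card * (p.support.card - 1) := by
  rcases eq_or_ne p 0 with rfl | hp
  · simp
  refine le_mul_pred_of_gap (fun e he hle => ?_) _ (natDegree_mem_support_of_nonzero hp)
  obtain ⟨m, hm⟩ : ∃ m, p.support.card = m + 1 :=
    Nat.exists_eq_add_one.mpr (Finset.card_pos.mpr (by simpa using hp))
  by_contra! H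
  rw [hm] at H hle
  obtain ⟨j, rfl⟩ := Nat.exists_eq_add_of_le' hle
  have hz : shiftedEulerOp (η / c) p.support.toList p = 0 := by
    conv_lhs => enter [2]; rw [← h, comp_eq_sum_left, Polynomial.sum]
    rw [map_sum]
    refine Finset.sum_eq_zero fun k hk => ?_
    rw [← smul_eq_C_mul, map_smul, shiftedEulerOp_pow hc, List.prod_eq_zero, zero_smul, smul_zero]
    simp only [List.mem_map, Finset.mem_toList]
    exact ⟨k, hk, sub_self _⟩
  have h0 : ∀ i, j < i → i < j + m + 1 → p.coeff i = 0 := by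
    intro i h1 h2
    by_contra hi
    have := H i (mem_support_iff.mpr hi) (by omega)
    omega
  have h1 := coeff_shiftedEulerOp (η / c) m p.support.toList (by simpa using hm) p j h0
  rw [hz, coeff_zero] at h1
  have h2 : (p.support.toList.map fun e : ℕ => (j : F) - e).prod * p.coeff j = 0 := by
    by_cases hj : p.coeff j = 0
    · simp [hj]
    · rw [List.prod_eq_zero, zero_mul]
      simp only [List.mem_map, Finset.mem_toList]
      exact ⟨j, mem_support_iff.mpr hj, sub_self _⟩
  rw [h2, zero_add] at h1
  have h3 := mem_support_iff.mp he
  refine mul_ne_zero (mul_ne_zero (pow_ne_zero _ (div_ne_zero hη hc)) ?_) h3 h1.symm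
  exact_mod_cast (Nat.ascFactorial_pos _ _).ne'

section DifferentialOperators

variable {R A : Type*} [CommRing R] [CommRing A] [Algebra R A] (δ : Derivation R A A)

/-- Composition with `δ` on the left, on differential operators `∑ aⱼ δ ^ j` encoded as the
polynomial `∑ aⱼ X ^ j`. -/
noncomputable def opDeriv : A[X] →ₗ[R] A[X] :=
  LinearMap.mulLeft R X + (PolynomialModule.equivPolynomialSelf.compDer δ.mapCoeffs).toLinearMap

theorem coeff_opDeriv_zero (T : A[X]) : (opDeriv δ T).coeff 0 = δ (T.coeff 0) := by
  have : (opDeriv δ T).coeff 0 = (X * T).coeff 0 + δ (T.coeff 0) := rfl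
  simp [this]

theorem coeff_opDeriv_succ (T : A[X]) (j : ℕ) :
    (opDeriv δ T).coeff (j + 1) = T.coeff j + δ (T.coeff (j + 1)) := by
  have : (opDeriv δ T).coeff (j + 1) = (X * T).coeff (j + 1) + δ (T.coeff (j + 1)) := rfl
  simp [this]

theorem opDeriv_C_mul (a : A) (T : A[X]) :
    opDeriv δ (C a * T) = C (δ a) * T + C a * opDeriv δ T := by
  ext j
  rcases j with _ | j
  · simp [coeff_opDeriv_zero]; ring
  · simp [coeff_opDeriv_succ]; ring

theorem natDegree_opDeriv_le (T : A[X]) : (opDeriv δ T).natDegree ≤ T.natDegree + 1 := by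
  refine natDegree_le_iff_coeff_eq_zero.mpr fun j hj => ?_
  obtain ⟨j, rfl⟩ := Nat.exists_eq_add_of_lt hj
  rw [coeff_opDeriv_succ, coeff_eq_zero_of_natDegree_lt, coeff_eq_zero_of_natDegree_lt, map_zero,
    add_zero] <;> omega

theorem coeff_opDeriv_natDegree (T : A[X]) :
    (opDeriv δ T).coeff (T.natDegree + 1) = T.leadingCoeff := by
  rw [coeff_opDeriv_succ, coeff_eq_zero_of_natDegree_lt (Nat.lt_succ_self _), map_zero, add_zero]
  rfl

theorem natDegree_opDeriv {T : A[X]} (hT : T ≠ 0) :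
    (opDeriv δ T).natDegree = T.natDegree + 1 :=
  (natDegree_opDeriv_le δ T).antisymm (le_natDegree_of_ne_zero
    (by rwa [coeff_opDeriv_natDegree, leadingCoeff_ne_zero]))

theorem opDeriv_ne_zero {T : A[X]} (hT : T ≠ 0) : opDeriv δ T ≠ 0 := by
  intro h
  have := natDegree_opDeriv δ hT
  simp [h] at this

theorem iterate_opDeriv_ne_zero {T : A[X]} (hT : T ≠ 0) (a : ℕ) : (opDeriv δ)^[a] T ≠ 0 := by
  induction a with
  | zero => exact hT
  | succ a ih => rw [Function.iterate_succ_apply']; exact opDeriv_ne_zero δ ih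

theorem natDegree_iterate_opDeriv {T : A[X]} (hT : T ≠ 0) (a : ℕ) :
    ((opDeriv δ)^[a] T).natDegree = T.natDegree + a := by
  induction a with
  | zero => rfl
  | succ a ih =>
    rw [Function.iterate_succ_apply', natDegree_opDeriv δ (iterate_opDeriv_ne_zero δ hT a), ih,
      add_assoc]

theorem natDegree_iterate_opDeriv_le (T : A[X]) (a : ℕ) :
    ((opDeriv δ)^[a] T).natDegree ≤ T.natDegree + a := by
  induction a with
  | zero => rfl
  | succ a ih =>
    rw [Function.iterate_succ_apply']
    exact (natDegree_opDeriv_le δ _).trans (by omega)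

/-- The differential operator `∑ aⱼ δ ^ j` attached to the polynomial `∑ aⱼ X ^ j`. -/
noncomputable def opEval : A[X] →ₗ[A] A →ₗ[R] A :=
  Polynomial.lsum fun j => LinearMap.toSpanSingleton A (A →ₗ[R] A) (δ.toLinearMap ^ j)

theorem opEval_monomial (j : ℕ) (a u : A) : opEval δ (monomial j a) u = a * δ^[j] u := by
  simp [opEval, Polynomial.lsum_apply, Module.End.pow_apply]

theorem opEval_C_mul (a : A) (T : A[X]) (u : A) : opEval δ (C a * T) u = a * opEval δ T u := by
  rw [← smul_eq_C_mul, map_smul]; rfl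

theorem opEval_C (a u : A) : opEval δ (C a) u = a * u := by
  rw [← monomial_zero_left, opEval_monomial]; rfl

theorem opEval_apply (T : A[X]) (u : A) : opEval δ T u = T.sum fun j a => a * δ^[j] u := by
  simp [opEval, Polynomial.lsum_apply, Polynomial.sum, LinearMap.sum_apply, Module.End.pow_apply]

theorem opDeriv_monomial (j : ℕ) (a : A) :
    opDeriv δ (monomial j a) = monomial (j + 1) a + monomial j (δ a) := by
  ext i
  rcases i with _ | i
  · rw [coeff_opDeriv_zero]
    rcases j with _ | j <;> simp [coeff_monomial]
  · rw [coeff_opDeriv_succ]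
    simp only [coeff_monomial, coeff_add, add_left_inj]
    split_ifs <;> simp

theorem opEval_opDeriv (T : A[X]) (u : A) : opEval δ (opDeriv δ T) u = δ (opEval δ T u) := by
  induction T using Polynomial.induction_on' with
  | add p q hp hq => simp [hp, hq]
  | monomial j a =>
    rw [opDeriv_monomial, map_add, LinearMap.add_apply, opEval_monomial, opEval_monomial,
      opEval_monomial, Derivation.leibniz, Function.iterate_succ_apply']
    simp [mul_comm]

theorem opEval_iterate_opDeriv (T : A[X]) (u : A) (a : ℕ) :
    opEval δ ((opDeriv δ)^[a] T) u = δ^[a] (opEval δ T u) := by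
  induction a with
  | zero => rfl
  | succ a ih => rw [Function.iterate_succ_apply', opEval_opDeriv, ih, Function.iterate_succ_apply']

/-- Composition of differential operators encoded as polynomials. -/
noncomputable def opComp (G : A[X]) : A[X] →ₗ[A] A[X] :=
  Polynomial.lsum fun a => LinearMap.toSpanSingleton A A[X] ((opDeriv δ)^[a] G)

theorem opComp_monomial (G : A[X]) (j : ℕ) (a : A) :
    opComp δ G (monomial j a) = C a * (opDeriv δ)^[j] G := by
  simp [opComp, Polynomial.lsum_apply, smul_eq_C_mul]

theorem opEval_opComp (G T : A[X]) (u : A) :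
    opEval δ (opComp δ G T) u = opEval δ T (opEval δ G u) := by
  induction T using Polynomial.induction_on' with
  | add p q hp hq => simp [hp, hq]
  | monomial j a =>
    rw [opComp_monomial, opEval_C_mul, opEval_iterate_opDeriv, opEval_monomial]

theorem opComp_mem_span (G T : A[X]) :
    opComp δ G T ∈ Submodule.span A (Set.range fun a => (opDeriv δ)^[a] G) := by
  induction T using Polynomial.induction_on' with
  | add p q hp hq => rw [map_add]; exact add_mem hp hq
  | monomial j a =>
    rw [opComp_monomial, ← smul_eq_C_mul]
    exact Submodule.smul_mem _ _ (Submodule.subset_span ⟨j, rfl⟩)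

theorem exists_opComp_eq_of_mem_span {G T : A[X]}
    (h : T ∈ Submodule.span A (Set.range fun a => (opDeriv δ)^[a] G)) :
    ∃ S, opComp δ G S = T := by
  rw [← LinearMap.mem_range]
  refine Submodule.span_le.mpr ?_ h
  rintro _ ⟨a, rfl⟩
  exact ⟨monomial a 1, by simp [opComp_monomial]⟩

theorem natDegree_opComp_le (G T : A[X]) :
    (opComp δ G T).natDegree ≤ T.natDegree + G.natDegree := by
  rw [opComp, Polynomial.lsum_apply, Polynomial.sum]
  refine natDegree_sum_le_of_forall_le _ _ fun j hj => ?_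
  rw [LinearMap.toSpanSingleton_apply]
  refine (natDegree_smul_le _ _).trans ((natDegree_iterate_opDeriv_le δ G j).trans ?_)
  have := le_natDegree_of_mem_supp j hj
  omega

theorem natDegree_opComp [IsDomain A] {G T : A[X]} (hG : G ≠ 0) (hT : T ≠ 0) :
    (opComp δ G T).natDegree = T.natDegree + G.natDegree := by
  refine (natDegree_opComp_le δ G T).antisymm (le_natDegree_of_ne_zero ?_)
  have h1 : (opComp δ G (monomial T.natDegree T.leadingCoeff)).coeff (T.natDegree + G.natDegree) ≠ 0 := by
    rw [opComp_monomial, coeff_C_mul, add_comm, ← natDegree_iterate_opDeriv δ hG]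
    exact mul_ne_zero (leadingCoeff_ne_zero.mpr hT)
      (leadingCoeff_ne_zero.mpr (iterate_opDeriv_ne_zero δ hG _))
  have h2 : (opComp δ G T.eraseLead).coeff (T.natDegree + G.natDegree) = 0 := by
    by_cases h0 : T.eraseLead = 0
    · simp [h0]
    · have := eraseLead_natDegree_lt_or_eraseLead_eq_zero T
      exact coeff_eq_zero_of_natDegree_lt ((natDegree_opComp_le δ G _).trans_lt (by grind))
  rw [← eraseLead_add_monomial_natDegree_leadingCoeff T] 
  rw [map_add, coeff_add]
  simp only [eraseLead_add_monomial_natDegree_leadingCoeff]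
  rwa [h2, zero_add]

theorem exists_opComp_add {K : Type*} [Field K] [Algebra R K] (δ : Derivation R K K) {G : K[X]}
    (hG : G ≠ 0) (T : K[X]) : ∃ S U, T = opComp δ G S + U ∧ U.degree < G.degree := by
  induction hn : T.degree using WellFoundedLT.induction generalizing T with
  | _ n ih =>
    subst hn
    by_cases hlt : T.degree < G.degree
    · exact ⟨0, T, by simp, hlt⟩
    have hT : T ≠ 0 := by rintro rfl; simp [bot_lt_iff_ne_bot, hG] at hlt
    have hle : G.natDegree ≤ T.natDegree := natDegree_le_natDegree (not_lt.mp hlt)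
    set M : K[X] := monomial (T.natDegree - G.natDegree) (T.leadingCoeff / G.leadingCoeff)
    have hM : (opComp δ G M) = C (T.leadingCoeff / G.leadingCoeff) *
      (opDeriv δ)^[T.natDegree - G.natDegree] G := opComp_monomial ..
    have hnd : ((opDeriv δ)^[T.natDegree - G.natDegree] G).natDegree = T.natDegree := by
      rw [natDegree_iterate_opDeriv δ hG]; omega
    have hlc : ∀ a, ((opDeriv δ)^[a] G).leadingCoeff = G.leadingCoeff := by
      intro a
      induction a with
      | zero => rfl
      | succ a ih =>
        rw [Function.iterate_succ_apply', leadingCoeff,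
          natDegree_opDeriv δ (iterate_opDeriv_ne_zero δ hG a), coeff_opDeriv_natDegree, ih]
    have hq : T.leadingCoeff / G.leadingCoeff ≠ 0 :=
      div_ne_zero (leadingCoeff_ne_zero.mpr hT) (leadingCoeff_ne_zero.mpr hG)
    have hsub : (T - opComp δ G M).degree < T.degree := by
      refine degree_sub_lt_left ?_ hT ?_
      · rw [hM, degree_C_mul hq, degree_eq_natDegree hT,
          degree_eq_natDegree (iterate_opDeriv_ne_zero δ hG _), hnd]
      · rw [hM, leadingCoeff_mul, leadingCoeff_C, hlc,
          div_mul_cancel₀ _ (leadingCoeff_ne_zero.mpr hG)]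
    obtain ⟨S, U, h, hU⟩ := ih _ hsub _ rfl
    refine ⟨S + M, U, ?_, hU⟩
    rw [map_add, add_right_comm, ← h, sub_add_cancel]

end DifferentialOperators

section Kernel

variable {F K : Type*} [Field F] [Field K] [Algebra F K] (δ : Derivation F K K)

theorem finrank_le_natDegree_of_le_ker_opEval
    (hδ : ∀ u, δ u = 0 → u ∈ (algebraMap F K).range) {T : K[X]} (hT : T ≠ 0)
    (W : Submodule F K) [FiniteDimensional F W] (hW : W ≤ LinearMap.ker (opEval δ T)) :
    Module.finrank F W ≤ T.natDegree := by
  induction hn : T.natDegree generalizing T W with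
  | zero =>
    rw [eq_C_of_natDegree_eq_zero hn] at hW hT
    have : W = ⊥ := by
      refine (Submodule.eq_bot_iff _).mpr fun u hu => ?_
      have := hW hu
      rw [LinearMap.mem_ker, opEval_C] at this
      simpa [show T.coeff 0 ≠ 0 by simpa using hT] using this
    simp [this]
  | succ n ih =>
    by_cases h0 : W = ⊥
    · rw [h0, finrank_bot]
      exact Nat.zero_le _
    obtain ⟨u, hu, hu0⟩ := Submodule.exists_mem_ne_zero_of_ne_bot h0
    set G : K[X] := X - C (δ u / u) with hGdef
    have hG : ∀ w, opEval δ G w = δ w - δ u / u * w := by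
      intro w
      rw [hGdef, map_sub, LinearMap.sub_apply, opEval_C, ← monomial_one_one_eq_X, opEval_monomial]
      simp
    have hG0 : G ≠ 0 := X_sub_C_ne_zero _
    obtain ⟨S, U, hSU, hU⟩ := exists_opComp_add δ hG0 T
    have hU0 : U = 0 := by
      rw [degree_X_sub_C, Nat.WithBot.lt_one_iff_le_zero] at hU
      rw [eq_C_of_degree_le_zero hU] at hSU ⊢
      have h1 : opEval δ T u = 0 := hW hu
      rw [hSU, map_add, LinearMap.add_apply, opEval_opComp, hG, div_mul_cancel₀ _ hu0, sub_self,
        map_zero, zero_add, opEval_C] at h1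
      rw [(mul_eq_zero.mp h1).resolve_right hu0, C_0]
    rw [hU0, add_zero] at hSU
    have hS : S ≠ 0 := by rintro rfl; exact hT (by simp [hSU])
    have hSn : S.natDegree = n := by
      have := natDegree_opComp δ hG0 hS
      rw [← hSU, hn, hGdef, natDegree_X_sub_C] at this
      omega
    have h1 := ih hS (W.map (opEval δ G)) (by
      rintro _ ⟨w, hw, rfl⟩
      have := hW hw
      rwa [LinearMap.mem_ker, hSU, opEval_opComp] at this) hSn
    have h2 := LinearMap.finrank_range_add_finrank_ker ((opEval δ G).domRestrict W)
    rw [LinearMap.range_domRestrict] at h2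
    have h3 : Module.finrank F (LinearMap.ker ((opEval δ G).domRestrict W)) ≤ 1 := by
      refine finrank_le_one ⟨⟨u, hu⟩, ?_⟩ ?_
      · simp [hG, hu0]
      · rintro ⟨⟨w, hw⟩, hw'⟩
        rw [LinearMap.mem_ker, LinearMap.domRestrict_apply, hG] at hw'
        obtain ⟨c, hc⟩ := hδ (w / u) (by
          rw [Derivation.leibniz_div]
          simp only [smul_eq_mul]
          field_simp at hw' ⊢
          linear_combination hw')
        refine ⟨c, ?_⟩
        ext
        simp [Algebra.smul_def, hc, hu0]
    omega

end Kernel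

theorem natDegree_le_of_comp_pow_of_monomial_add_C {f : ℂ[X]} {a b c : ℂ} {k m : ℕ} (ha : a ≠ 0)
    (hb : b ≠ 0) (hk : 0 < k) (hm : 2 ≤ m) :
    f.natDegree ≤ (f.comp ((C a * X ^ k + C b) ^ m + C c)).support.card *
      ((f.comp ((C a * X ^ k + C b) ^ m + C c)).support.card - 1) := by
  set G : ℂ[X] := f.comp ((C a * X + C b) ^ m + C c) with hG
  have hexp : f.comp ((C a * X ^ k + C b) ^ m + C c) = expand ℂ k G := by
    rw [expand_eq_comp_X_pow, hG, comp_assoc]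
    simp
  have hcard : (expand ℂ k G).support.card = G.support.card := by
    rw [← Finset.card_image_of_injective G.support (mul_left_injective₀ hk.ne')]
    congr 1
    ext i
    simp only [mem_support_iff, coeff_expand hk, Finset.mem_image, ne_eq, ite_eq_right_iff,
      Classical.not_imp]
    constructor
    · rintro ⟨⟨j, rfl⟩, h⟩
      rw [Nat.mul_div_cancel_left _ hk] at h
      exact ⟨j, h, mul_comm ..⟩
    · rintro ⟨j, h, rfl⟩
      rw [Nat.mul_div_cancel _ hk]
      exact ⟨dvd_mul_left .., h⟩
  rw [hexp, hcard]
  have hω := Complex.isPrimitiveRoot_exp m (by omega)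
  set ω := Complex.exp (2 * Real.pi * Complex.I / m)
  have hω0 : ω ≠ 0 := hω.ne_zero (by omega)
  have hω1 : ω ≠ 1 := hω.ne_one (by omega)
  have hdeg : f.natDegree ≤ G.natDegree := by
    rw [hG, natDegree_comp, natDegree_add_C, natDegree_pow, natDegree_linear ha]
    exact Nat.le_mul_of_pos_right _ (by omega)
  refine hdeg.trans (natDegree_le_of_comp_linear_eq (c := ω) (η := (ω * b - b) / a) hω0
    (div_ne_zero ?_ ha) ?_)
  · have : ω * b - b = (ω - 1) * b := by ring
    rw [this]
    exact mul_ne_zero (sub_ne_zero.mpr hω1) hb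
  · rw [hG, comp_assoc]
    congr 1
    simp only [add_comp, pow_comp, mul_comp, C_comp, X_comp]
    have : C a * (C ω * X + C ((ω * b - b) / a)) + C b = C ω * (C a * X + C b) := by
      rw [mul_add, ← C_mul, mul_div_cancel₀ _ ha, C_sub, C_mul]
      ring
    rw [this, mul_pow, ← C_pow, hω.pow_eq_one, C_1, one_mul]

theorem exists_eq_sum_comp_mul_X_pow {F : Type*} [Field F] {g : F[X]} (hg : 0 < g.natDegree)
    (p : F[X]) (N : ℕ) (hp : p.natDegree ≤ N) :
    ∃ q : ℕ → F[X], p = ∑ i ∈ Finset.range g.natDegree, (q i).comp g * X ^ i ∧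
      ∀ i m, N < g.natDegree * m + i → (q i).coeff m = 0 := by
  induction N using Nat.strong_induction_on generalizing p with
  | _ N ih =>
    by_cases hlt : p.natDegree < g.natDegree
    · refine ⟨fun i => C (p.coeff i), ?_, fun i m hm => ?_⟩
      · conv_lhs => rw [p.as_sum_range' _ hlt]
        simp [C_mul_X_pow_eq_monomial]
      · rcases m with _ | m
        · rw [coeff_C_zero]
          exact coeff_eq_zero_of_natDegree_lt (by omega)
        · rw [coeff_C_succ]
    · rw [not_lt] at hlt
      have hg0 : g ≠ 0 := ne_zero_of_natDegree_gt hg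
      have hp0 : p ≠ 0 := ne_zero_of_natDegree_gt (hg.trans_le hlt)
      have hdiv : (p / g).natDegree ≤ N - g.natDegree := by
        rcases eq_or_ne (p / g) 0 with h0 | h0
        · simp [h0]
        · have h1 := degree_add_div (p := p) hg0 (by
            rw [degree_eq_natDegree hg0, degree_eq_natDegree hp0]
            exact_mod_cast hlt)
          rw [degree_eq_natDegree hg0, degree_eq_natDegree h0,
            degree_eq_natDegree hp0] at h1
          norm_cast at h1
          omega
      obtain ⟨q, hq, hqc⟩ := ih (N - g.natDegree) (by omega) (p / g) hdiv
      refine ⟨fun i => X * q i + C ((p % g).coeff i), ?_, fun i m hm => ?_⟩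
      · have hmod := natDegree_mod_lt p hg.ne'
        conv_lhs => rw [← EuclideanDomain.div_add_mod p g, hq, (p % g).as_sum_range' _ hmod,
          Finset.mul_sum, ← Finset.sum_add_distrib]
        refine Finset.sum_congr rfl fun i _ => ?_
        simp only [add_comp, mul_comp, X_comp, C_comp, ← C_mul_X_pow_eq_monomial]
        ring
      · rcases m with _ | m
        · simp only [coeff_add, mul_coeff_zero, coeff_X_zero, zero_mul, coeff_C_zero, zero_add]
          have := natDegree_mod_lt p hg.ne'
          exact coeff_eq_zero_of_natDegree_lt (by omega)
        · rw [coeff_add, coeff_X_mul, coeff_C_succ, add_zero]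
          refine hqc i m ?_
          rw [Nat.mul_succ] at hm
          omega

theorem comp_ne_zero_of_natDegree_pos {F : Type*} [Field F] {f g : F[X]} (hf : f ≠ 0)
    (hg : 0 < g.natDegree) : f.comp g ≠ 0 := fun h => by
  rcases comp_eq_zero_iff.mp h with h | ⟨-, h⟩
  · exact hf h
  · rw [h, natDegree_C] at hg
    exact hg.false

theorem eq_zero_of_sum_comp_mul_X_pow_eq_zero {F : Type*} [Field F] {g : F[X]}
    {q : ℕ → F[X]} (h : ∑ i ∈ Finset.range g.natDegree, (q i).comp g * X ^ i = 0) :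
    ∀ i < g.natDegree, q i = 0 := by
  by_contra! H
  obtain ⟨i, hi, hqi⟩ := H
  have hg : 0 < g.natDegree := by omega
  have hdeg : ∀ i, q i ≠ 0 → ((q i).comp g * X ^ i).natDegree =
      (q i).natDegree * g.natDegree + i := fun i hi => by
    rw [natDegree_mul_X_pow _ (comp_ne_zero_of_natDegree_pos hi hg), natDegree_comp]
  have hsum := degree_sum_eq_of_disjoint (fun i => (q i).comp g * X ^ i)
    (Finset.range g.natDegree) (by
      rintro a ⟨ha, ha0⟩ b ⟨hb, hb0⟩ hab heq
      have h1 := natDegree_eq_of_degree_eq heq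
      rw [hdeg a (by rintro h0; simp [h0] at ha0), hdeg b (by rintro h0; simp [h0] at hb0)] at h1
      have h2 := congrArg (· % g.natDegree) h1
      simp only [Nat.mul_add_mod_self_right, Nat.mod_eq_of_lt (Finset.mem_range.mp ha),
        Nat.mod_eq_of_lt (Finset.mem_range.mp hb)] at h2
      exact hab h2)
  rw [h, degree_zero] at hsum
  have h3 := Finset.le_sup (f := fun i => ((q i).comp g * X ^ i).degree) (Finset.mem_range.mpr hi)
  rw [← hsum, le_bot_iff, degree_eq_bot] at h3
  exact mul_ne_zero (comp_ne_zero_of_natDegree_pos hqi hg) (pow_ne_zero _ X_ne_zero) h3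

theorem exists_eq_pow_of_dvd_rootMultiplicity {F : Type*} [Field F] [IsAlgClosed F] {p : F[X]}
    {m : ℕ} (hm : 0 < m) (h : ∀ z, m ∣ p.rootMultiplicity z) : ∃ q : F[X], q ^ m = p := by
  classical
  rcases eq_or_ne p 0 with rfl | hp
  · exact ⟨0, zero_pow hm.ne'⟩
  obtain ⟨a, ha⟩ := IsAlgClosed.exists_pow_nat_eq p.leadingCoeff hm
  refine ⟨C a * ∏ z ∈ p.roots.toFinset, (X - C z) ^ (p.rootMultiplicity z / m), ?_⟩
  conv_rhs => rw [(IsAlgClosed.splits p).eq_prod_roots, Finset.prod_multiset_map_count]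
  rw [mul_pow, ← C_pow, ha, ← Finset.prod_pow]
  congr 1
  refine Finset.prod_congr rfl fun z _ => ?_
  rw [← pow_mul, Nat.div_mul_cancel (h z), count_roots]

theorem rootMultiplicity_pow_eq {R : Type*} [CommRing R] [IsDomain R] (p : R[X]) (n : ℕ) (z : R) :
    (p ^ n).rootMultiplicity z = n * p.rootMultiplicity z := by
  classical
  rw [← count_roots, roots_pow, Multiset.count_nsmul, count_roots]

theorem rootMultiplicity_comp_eq {F : Type*} [Field F] {q g : F[X]} (hq : q ≠ 0) {c z : F}
    (hz : g.eval z = c) (hg : g - C c ≠ 0) :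
    (q.comp g).rootMultiplicity z = q.rootMultiplicity c * (g - C c).rootMultiplicity z := by
  obtain ⟨r, hr, hrc⟩ := exists_eq_pow_rootMultiplicity_mul_and_not_dvd q hq c
  have h1 : q.comp g = (g - C c) ^ q.rootMultiplicity c * r.comp g := by
    conv_lhs => rw [hr]
    simp
  have h2 : (r.comp g).eval z ≠ 0 := by
    rw [eval_comp, hz]
    exact fun h => hrc (dvd_iff_isRoot.mpr h)
  have h3 : r.comp g ≠ 0 := fun h => h2 (by simp [h])
  rw [h1, rootMultiplicity_mul (mul_ne_zero (pow_ne_zero _ hg) h3), rootMultiplicity_pow_eq,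
    rootMultiplicity_eq_zero h2, add_zero]

theorem exists_comp_of_pow_eq_comp {F : Type*} [Field F] [IsAlgClosed F] {v q g : F[X]}
    (hg : 0 < g.natDegree) (hv : v ≠ 0) (h : v ^ g.natDegree = q.comp g) :
    (∃ s : F[X], v = s.comp g) ∨ ∃ (m : ℕ) (k : F[X]) (c : F), 2 ≤ m ∧ g = k ^ m + C c := by
  have hq : q ≠ 0 := by
    rintro rfl
    exact pow_ne_zero _ hv (by simpa using h)
  have hgc : ∀ c, g - C c ≠ 0 := fun c h0 => by
    rw [sub_eq_zero.mp h0, natDegree_C] at hg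
    exact hg.false
  by_cases hdvd : ∀ c, g.natDegree ∣ q.rootMultiplicity c
  · left
    obtain ⟨s, rfl⟩ := exists_eq_pow_of_dvd_rootMultiplicity hg hdvd
    rw [pow_comp] at h
    have h1 : Associated (s.comp g) v := by
      refine associated_of_dvd_dvd ?_ ?_ <;>
        rw [← IsIntegrallyClosed.pow_dvd_pow_iff hg.ne', h]
    obtain ⟨u, hu⟩ := h1
    obtain ⟨c, -, hc⟩ := isUnit_iff.mp u.isUnit
    refine ⟨s * C c, ?_⟩
    rw [mul_comp, C_comp, hc, hu]
  · right
    push Not at hdvd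
    obtain ⟨c, hc⟩ := hdvd
    have hd : 0 < Nat.gcd g.natDegree (q.rootMultiplicity c) := Nat.gcd_pos_of_pos_left _ hg
    set m := g.natDegree / Nat.gcd g.natDegree (q.rootMultiplicity c) with hm
    have hmg := Nat.div_mul_cancel (Nat.gcd_dvd_left g.natDegree (q.rootMultiplicity c))
    rw [← hm] at hmg
    have hm2 : 2 ≤ m := by
      by_contra! hlt
      interval_cases m
      · omega
      · exact hc (by rw [← hmg, one_mul]; exact Nat.gcd_dvd_right _ _)
    obtain ⟨k, hk⟩ := exists_eq_pow_of_dvd_rootMultiplicity (p := g - C c) (by omega : 0 < m) (by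
      intro z
      by_cases hz : g.eval z = c
      · have h1 := rootMultiplicity_comp_eq hq hz (hgc c)
        rw [← h, rootMultiplicity_pow_eq] at h1
        have h2 : g.natDegree ∣ q.rootMultiplicity c * (g - C c).rootMultiplicity z :=
          ⟨_, h1.symm⟩
        exact (Nat.coprime_div_gcd_div_gcd hd).dvd_of_dvd_mul_left (by
          refine Nat.dvd_of_mul_dvd_mul_right hd ?_
          rw [← hm, hmg, mul_right_comm, Nat.div_mul_cancel (Nat.gcd_dvd_right _ _)]
          exact h2)
      · rw [rootMultiplicity_eq_zero (by simpa [sub_eq_zero] using hz)]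
        exact dvd_zero _)
    exact ⟨m, k, c, hm2, by rw [hk, sub_add_cancel]⟩

section Compatibility

variable {R A B : Type*} [CommRing R] [CommRing A] [CommRing B] [Algebra R A] [Algebra R B]
  {δ : Derivation R A A} {δ' : Derivation R B B} {φ : A →+* B}

theorem map_opDeriv (h : ∀ a, φ (δ a) = δ' (φ a)) (T : A[X]) :
    (opDeriv δ T).map φ = opDeriv δ' (T.map φ) := by
  ext j
  rcases j with _ | j
  · simp [coeff_opDeriv_zero, h]
  · simp [coeff_opDeriv_succ, h]

theorem map_iterate_opDeriv (h : ∀ a, φ (δ a) = δ' (φ a)) (T : A[X]) (n : ℕ) :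
    ((opDeriv δ)^[n] T).map φ = (opDeriv δ')^[n] (T.map φ) := by
  induction n with
  | zero => rfl
  | succ n ih => rw [Function.iterate_succ_apply', map_opDeriv h, ih, Function.iterate_succ_apply']

theorem map_iterate_derivation (h : ∀ a, φ (δ a) = δ' (φ a)) (u : A) (n : ℕ) :
    φ (δ^[n] u) = δ'^[n] (φ u) := by
  induction n with
  | zero => rfl
  | succ n ih => rw [Function.iterate_succ_apply', h, ih, Function.iterate_succ_apply']

theorem opEval_map (h : ∀ a, φ (δ a) = δ' (φ a)) (T : A[X]) (u : A) :
    opEval δ' (T.map φ) (φ u) = φ (opEval δ T u) := by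
  induction T using Polynomial.induction_on' with
  | add p q hp hq => simp [hp, hq]
  | monomial j a =>
    rw [map_monomial, opEval_monomial, opEval_monomial, map_mul, map_iterate_derivation h]

end Compatibility

open TensorProduct in
theorem exists_derivation_extension {R S T : Type*} [CommRing R] [CommRing S] [CommRing T]
    [Algebra R S] [Algebra R T] [Algebra S T] [IsScalarTower R S T] [Algebra.FormallyEtale S T]
    (δ : Derivation R S S) :
    ∃ δ' : Derivation R T T, ∀ s, algebraMap S T (δ s) = δ' (algebraMap S T s) := by
  let L : Ω[S⁄R] →ₗ[S] T := ((Algebra.linearMap S T).compDer δ).liftKaehlerDifferential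
  let E : Ω[T⁄R] →ₗ[T] T := (L.liftBaseChange T) ∘ₗ
    (KaehlerDifferential.tensorKaehlerEquivOfFormallyEtale R S T).symm.toLinearMap
  refine ⟨E.compDer (KaehlerDifferential.D R T), fun s => ?_⟩
  have : E (KaehlerDifferential.D R T (algebraMap S T s)) = algebraMap S T (δ s) := by
    simp only [E, LinearMap.comp_apply, LinearEquiv.coe_coe]
    rw [KaehlerDifferential.tensorKaehlerEquivOfFormallyEtale_symm_D_algebraMap]
    simp [L]
  exact this.symm

section AlgebraicExtension

variable {F k Ω : Type*} [Field F] [Field k] [Field Ω] [Algebra F k] [Algebra F Ω] [Algebra k Ω]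
  {δ : Derivation F k k} {δ' : Derivation F Ω Ω}

theorem derivation_aeval (h : ∀ a, algebraMap k Ω (δ a) = δ' (algebraMap k Ω a)) (p : k[X])
    (u : Ω) :
    δ' (aeval u p) = aeval u (opDeriv δ p - X * p) + aeval u (derivative p) * δ' u := by
  induction p using Polynomial.induction_on' with
  | add p q hp hq =>
    simp only [map_add, mul_add, map_sub, map_mul, aeval_X] at hp hq ⊢
    rw [hp, hq]
    ring
  | monomial j a =>
    rw [opDeriv_monomial, X_mul_monomial, add_sub_cancel_left, aeval_monomial, Derivation.leibniz,
      Derivation.leibniz_pow, ← h, derivative_monomial, aeval_monomial, aeval_monomial]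
    simp only [smul_eq_mul, nsmul_eq_mul, map_mul, map_natCast]
    ring

theorem derivation_commute_algEquiv [Algebra.IsSeparable k Ω]
    (h : ∀ a, algebraMap k Ω (δ a) = δ' (algebraMap k Ω a)) (σ : Ω ≃ₐ[k] Ω) (u : Ω) :
    σ (δ' u) = δ' (σ u) := by
  have h0 := (Algebra.IsSeparable.isSeparable k u).aeval_derivative_ne_zero (minpoly.aeval k u)
  have h1 := derivation_aeval h (minpoly k u) u
  have h2 := derivation_aeval h (minpoly k u) (σ u)
  have hσ : ∀ q : k[X], aeval (σ u) q = σ (aeval u q) := fun q => aeval_algHom_apply σ u q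
  rw [hσ, hσ, hσ, minpoly.aeval, map_zero, map_zero] at h2
  rw [minpoly.aeval, map_zero] at h1
  have h3 := congrArg σ h1
  rw [map_zero, map_add, map_mul] at h3
  refine mul_left_cancel₀ ((map_ne_zero σ).mpr h0) ?_
  linear_combination h2 - h3

theorem mem_range_of_derivation_eq_zero [IsAlgClosed F] [IsScalarTower F k Ω]
    [Algebra.IsAlgebraic k Ω]
    (h : ∀ a, algebraMap k Ω (δ a) = δ' (algebraMap k Ω a))
    (hk : ∀ a, δ a = 0 → a ∈ (algebraMap F k).range) {u : Ω} (hu : δ' u = 0) :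
    u ∈ (algebraMap F Ω).range := by
  have hint := Algebra.IsIntegral.isIntegral (R := k) u
  have h1 := derivation_aeval h (minpoly k u) u
  rw [hu, mul_zero, add_zero, minpoly.aeval, map_zero] at h1
  have hcoeff : ∀ j, (opDeriv δ (minpoly k u) - X * minpoly k u).coeff j =
      δ ((minpoly k u).coeff j) := by
    rintro (_ | j)
    · simp [coeff_opDeriv_zero]
    · simp [coeff_opDeriv_succ]
  have h2 : opDeriv δ (minpoly k u) - X * minpoly k u = 0 := by
    by_contra hne
    refine (minpoly.degree_le_of_ne_zero k u hne h1.symm).not_gt ?_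
    rw [degree_eq_natDegree (minpoly.ne_zero hint), degree_lt_iff_coeff_zero]
    intro j hj
    rw [hcoeff]
    rcases hj.eq_or_lt with rfl | hj
    · rw [(minpoly.monic hint).coeff_natDegree, Derivation.map_one_eq_zero]
    · rw [coeff_eq_zero_of_natDegree_lt hj, map_zero]
  obtain ⟨p, hp⟩ : minpoly k u ∈ Set.range (Polynomial.map (algebraMap F k)) := by
    rw [← lifts_iff_set_range, lifts_iff_coeff_lifts]
    exact fun j => hk _ (by rw [← hcoeff, h2, coeff_zero])
  have hp0 : p ≠ 0 := by
    rintro rfl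
    exact minpoly.ne_zero hint (by rw [← hp, Polynomial.map_zero])
  have hu' : IsAlgebraic F u := ⟨p, hp0, by
    rw [← aeval_map_algebraMap k, hp, minpoly.aeval]⟩
  exact minpoly.mem_range_of_degree_eq_one F u
    (IsAlgClosed.degree_eq_one_of_irreducible F (minpoly.irreducible hu'.isIntegral))

end AlgebraicExtension

theorem mem_range_of_fractionRing_derivation_eq_zero {F k : Type*} [Field F] [CharZero F] [Field k]
    [Algebra F[X] k] [IsFractionRing F[X] k] [Algebra F k] [IsScalarTower F F[X] k]
    {δ : Derivation F k k}
    (h : ∀ p : F[X], algebraMap F[X] k (derivative p) = δ (algebraMap F[X] k p)) {u : k}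
    (hu : δ u = 0) : u ∈ (algebraMap F k).range := by
  obtain ⟨a, b, hab, hb⟩ := IsFractionRing.exists_reduced_fraction (A := F[X]) u
  have hb0 : algebraMap F[X] k b ≠ 0 := by simp
  rw [IsFractionRing.mk'_eq_div] at hb
  rw [← hb, Derivation.leibniz_div, ← h, ← h] at hu
  have h1 : (b : F[X]) * derivative a = a * derivative b := by
    apply IsFractionRing.injective F[X] k
    simp only [smul_eq_mul] at hu
    field_simp at hu
    rw [map_mul, map_mul]
    linear_combination hu
  have h2 : (b : F[X]) ∣ derivative (b : F[X]) := hab.symm.dvd_of_dvd_mul_left (Dvd.intro _ h1)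
  have h3 := eq_zero_of_dvd_of_degree_lt h2 (degree_derivative_lt (by simp))
  rw [h3, mul_zero, mul_eq_zero, or_iff_right (by simp)] at h1
  obtain ⟨α, hα⟩ := natDegree_eq_zero.mp (derivative_eq_zero.mp h1)
  obtain ⟨β, hβ⟩ := natDegree_eq_zero.mp (derivative_eq_zero.mp h3)
  refine ⟨α / β, ?_⟩
  rw [← hb, ← hα, ← hβ, map_div₀, IsScalarTower.algebraMap_apply F F[X] k,
    IsScalarTower.algebraMap_apply F F[X] k]
  rfl

section Annihilator

variable {F : Type*} [Field F] (g : F[X])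

/-- The operator `f ↦ ∏ (X d/dX - e) (f ∘ g)`, the product being over the list, is
`∑ Pⱼ (f⁽ʲ⁾ ∘ g)` for the polynomials `Pⱼ` which are the coefficients of `eulerAnnihilator`. -/
noncomputable def eulerAnnihilator : List ℕ → F[X][X]
  | [] => 1
  | e :: l => C X * (opDeriv derivative' (eulerAnnihilator l) - X * eulerAnnihilator l) +
      C (X * derivative g) * (X * eulerAnnihilator l) - C (C (e : F)) * eulerAnnihilator l

theorem coeff_eulerAnnihilator_cons_zero (e : ℕ) (l : List ℕ) :
    (eulerAnnihilator g (e :: l)).coeff 0 = X * derivative ((eulerAnnihilator g l).coeff 0) -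
      C (e : F) * (eulerAnnihilator g l).coeff 0 := by
  rw [eulerAnnihilator]
  simp only [coeff_sub, coeff_add, coeff_opDeriv_zero, mul_coeff_zero, coeff_X_zero]
  simp

theorem coeff_eulerAnnihilator_cons_succ (e : ℕ) (l : List ℕ) (j : ℕ) :
    (eulerAnnihilator g (e :: l)).coeff (j + 1) =
      X * derivative ((eulerAnnihilator g l).coeff (j + 1)) +
      X * derivative g * (eulerAnnihilator g l).coeff j -
      C (e : F) * (eulerAnnihilator g l).coeff (j + 1) := by
  rw [eulerAnnihilator]
  simp only [coeff_sub, coeff_add, coeff_C_mul, coeff_opDeriv_succ, coeff_X_mul]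
  simp

theorem natDegree_X_mul_derivative_le (p : F[X]) : (X * derivative p).natDegree ≤ p.natDegree := by
  rcases Nat.eq_zero_or_pos p.natDegree with h | h
  · rw [eq_C_of_natDegree_eq_zero h]
    simp
  · refine natDegree_mul_le.trans ?_
    have := natDegree_derivative_le p
    have := natDegree_X_le (R := F)
    omega

theorem natDegree_coeff_eulerAnnihilator_le (l : List ℕ) (j : ℕ) :
    ((eulerAnnihilator g l).coeff j).natDegree ≤ g.natDegree * j := by
  induction l generalizing j with
  | nil =>
    rw [eulerAnnihilator, coeff_one]
    split_ifs <;> simp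
  | cons e l ih =>
    rcases j with _ | j
    · rw [coeff_eulerAnnihilator_cons_zero]
      exact (natDegree_sub_le_of_le ((natDegree_X_mul_derivative_le _).trans (ih 0))
        ((natDegree_C_mul_le _ _).trans (ih 0))).trans (max_self _).le
    · rw [coeff_eulerAnnihilator_cons_succ]
      refine (natDegree_sub_le_of_le (natDegree_add_le_of_degree_le
        ((natDegree_X_mul_derivative_le _).trans (ih (j + 1))) ?_)
        ((natDegree_C_mul_le _ _).trans (ih (j + 1)))).trans (max_self _).le
      exact natDegree_mul_le.trans
        ((Nat.add_le_add (natDegree_X_mul_derivative_le g) (ih j)).trans (by ring_nf; rfl))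

theorem natDegree_eulerAnnihilator_le (l : List ℕ) :
    (eulerAnnihilator g l).natDegree ≤ l.length := by
  induction l with
  | nil => simp [eulerAnnihilator]
  | cons e l ih =>
    refine natDegree_le_iff_coeff_eq_zero.mpr fun j hj => ?_
    obtain ⟨j, rfl⟩ := Nat.exists_eq_add_of_lt hj
    rw [List.length_cons, coeff_eulerAnnihilator_cons_succ,
      coeff_eq_zero_of_natDegree_lt (by omega), coeff_eq_zero_of_natDegree_lt (by omega)]
    simp

theorem coeff_eulerAnnihilator_length (l : List ℕ) :
    (eulerAnnihilator g l).coeff l.length = (X * derivative g) ^ l.length := by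
  induction l with
  | nil => simp [eulerAnnihilator]
  | cons e l ih =>
    rw [List.length_cons, coeff_eulerAnnihilator_cons_succ, ih, coeff_eq_zero_of_natDegree_lt
      (Nat.lt_succ_of_le (natDegree_eulerAnnihilator_le g l)), pow_succ]
    simp [mul_comm]

/-- The map `∑ Pⱼ X ^ j ↦ ∑ Pⱼ (f⁽ʲ⁾ ∘ g)`. -/
noncomputable def opEvalComp (f : F[X]) : F[X][X] →ₗ[F[X]] F[X] :=
  Polynomial.lsum fun j => LinearMap.toSpanSingleton F[X] F[X] ((derivative^[j] f).comp g)

theorem opEvalComp_monomial (f : F[X]) (j : ℕ) (a : F[X]) :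
    opEvalComp g f (monomial j a) = a * (derivative^[j] f).comp g := by
  simp [opEvalComp, Polynomial.lsum_apply]

theorem opEvalComp_C_mul (f a : F[X]) (T : F[X][X]) :
    opEvalComp g f (C a * T) = a * opEvalComp g f T := by
  rw [← smul_eq_C_mul, map_smul, smul_eq_mul]

theorem derivative_opEvalComp (f : F[X]) (T : F[X][X]) :
    derivative (opEvalComp g f T) = opEvalComp g f (opDeriv derivative' T - X * T) +
      derivative g * opEvalComp g f (X * T) := by
  induction T using Polynomial.induction_on' with
  | add p q hp hq =>
    simp only [map_add, mul_add, map_sub] at hp hq ⊢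
    rw [hp, hq]
    ring
  | monomial j a =>
    rw [opDeriv_monomial, X_mul_monomial, add_sub_cancel_left, opEvalComp_monomial,
      opEvalComp_monomial, opEvalComp_monomial, derivative_mul, derivative_comp,
      Function.iterate_succ_apply']
    simp only [derivative'_apply]
    ring

theorem coeff_opEvalComp_eulerAnnihilator (f : F[X]) (l : List ℕ) (i : ℕ) :
    (opEvalComp g f (eulerAnnihilator g l)).coeff i =
      (l.map fun e : ℕ => (i : F) - e).prod * (f.comp g).coeff i := by
  induction l with
  | nil =>
    rw [eulerAnnihilator, ← monomial_zero_one, opEvalComp_monomial]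
    simp
  | cons e l ih =>
    have h : opEvalComp g f (eulerAnnihilator g (e :: l)) =
        X * derivative (opEvalComp g f (eulerAnnihilator g l)) -
        C (e : F) * opEvalComp g f (eulerAnnihilator g l) := by
      rw [eulerAnnihilator, map_sub, map_add, opEvalComp_C_mul, opEvalComp_C_mul,
        opEvalComp_C_mul, derivative_opEvalComp]
      ring
    have h2 : ∀ p : F[X], (X * derivative p).coeff i = i * p.coeff i := by
      intro p
      rcases i with _ | i
      · simp
      · rw [coeff_X_mul, coeff_derivative]
        push_cast
        ring
    rw [h, coeff_sub, h2, coeff_C_mul, ih, List.map_cons, List.prod_cons]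
    ring

theorem opEvalComp_eulerAnnihilator_eq_zero {f : F[X]} {l : List ℕ}
    (h : ∀ e ∈ (f.comp g).support, e ∈ l) : opEvalComp g f (eulerAnnihilator g l) = 0 := by
  ext i
  rw [coeff_opEvalComp_eulerAnnihilator, coeff_zero]
  by_cases hi : (f.comp g).coeff i = 0
  · rw [hi, mul_zero]
  · rw [List.prod_eq_zero (List.mem_map.mpr ⟨i, h i (mem_support_iff.mpr hi), sub_self _⟩),
      zero_mul]

theorem opEval_eulerAnnihilator_pow {Ω : Type*} [Field Ω] [Algebra F Ω] {δ : Derivation F Ω Ω}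
    {x : Ω} (hx : aeval x (derivative g) * δ x = 1) (l : List ℕ) (i : ℕ) :
    opEval δ ((eulerAnnihilator g l).map (aeval x : F[X] →ₐ[F] Ω).toRingHom) (x ^ i) =
      (l.map fun e : ℕ => (i : Ω) - e).prod * x ^ i := by
  induction l with
  | nil =>
    rw [eulerAnnihilator, Polynomial.map_one, ← C_1, opEval_C]
    simp
  | cons e l ih =>
    set φ : F[X] →+* Ω := (aeval x : F[X] →ₐ[F] Ω).toRingHom with hφ
    have hφa : ∀ p, φ p = aeval x p := fun _ => rfl
    have h : (eulerAnnihilator g (e :: l)).map φ =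
        C (x * aeval x (derivative g)) * opDeriv δ ((eulerAnnihilator g l).map φ) -
        C (e : Ω) * (eulerAnnihilator g l).map φ := by
      have hδ : ∀ p : F[X], aeval x (derivative g) * δ (aeval x p) = aeval x (derivative p) := by
        intro p
        rw [Derivation.map_aeval, smul_eq_mul]
        linear_combination aeval x (derivative p) * hx
      ext j
      rcases j with _ | j
      · rw [coeff_map, coeff_eulerAnnihilator_cons_zero, coeff_sub, coeff_C_mul, coeff_C_mul,
          coeff_opDeriv_zero, coeff_map]
        simp only [hφa, map_sub, map_mul, aeval_X, map_natCast]
        rw [mul_assoc, hδ]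
      · rw [coeff_map, coeff_eulerAnnihilator_cons_succ, coeff_sub, coeff_C_mul, coeff_C_mul,
          coeff_opDeriv_succ, coeff_map, coeff_map]
        simp only [hφa, map_sub, map_add, map_mul, aeval_X, map_natCast]
        rw [mul_add, mul_assoc x _ (δ _), hδ]
        ring
    rw [h, map_sub, LinearMap.sub_apply, opEval_C_mul, opEval_C_mul, opEval_opDeriv, ih,
      Derivation.leibniz, Derivation.leibniz_pow, List.map_cons, List.prod_cons]
    have hc : δ (l.map fun e : ℕ => (i : Ω) - e).prod = 0 := by
      have : (l.map fun e : ℕ => (i : Ω) - e).prod =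
          algebraMap F Ω (l.map fun e : ℕ => (i : F) - e).prod := by
        rw [map_list_prod, List.map_map]
        congr 1
        refine List.map_congr_left fun e _ => ?_
        simp
      rw [this, Derivation.map_algebraMap]
    rw [hc]
    rcases i with _ | i
    · simp
    · simp only [smul_eq_mul, nsmul_eq_mul, Nat.add_sub_cancel]
      linear_combination (l.map fun e : ℕ => ((i + 1 : ℕ) : Ω) - e).prod *
        ((i + 1 : ℕ) : Ω) * x ^ (i + 1) * hx

end Annihilator

section Rows

variable {F : Type*} [Field F] {g : F[X]}

theorem exists_annihilating_rows (hg : 0 < g.natDegree) (l : List ℕ) :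
    ∃ R : ℕ → F[X][X], (∀ i, (R i).natDegree ≤ l.length) ∧
      (∀ j, (eulerAnnihilator g l).coeff j =
        ∑ i ∈ Finset.range g.natDegree, ((R i).coeff j).comp g * X ^ i) ∧
      ∀ i j m, g.natDegree * j < g.natDegree * m + i → ((R i).coeff j).coeff m = 0 := by
  choose q hq hqc using fun j => exists_eq_sum_comp_mul_X_pow hg ((eulerAnnihilator g l).coeff j)
    (g.natDegree * j) (natDegree_coeff_eulerAnnihilator_le g l j)
  have hcoeff : ∀ i j, (∑ j ∈ Finset.range (l.length + 1), monomial j (q j i)).coeff j =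
      if j ≤ l.length then q j i else 0 := by
    intro i j
    simp [coeff_monomial]
  refine ⟨fun i => ∑ j ∈ Finset.range (l.length + 1), monomial j (q j i), fun i => ?_,
    fun j => ?_, fun i j m hm => ?_⟩
  · exact natDegree_le_iff_coeff_eq_zero.mpr fun j hj => by rw [hcoeff, if_neg (by omega)]
  · simp only [hcoeff]
    split_ifs with h
    · exact hq j
    · rw [coeff_eq_zero_of_natDegree_lt
        ((natDegree_eulerAnnihilator_le g l).trans_lt (not_le.mp h))]
      simp
  · simp only [hcoeff]
    split_ifs
    · exact hqc j i m hm
    · simp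

theorem opEval_row_eq_zero {f : F[X]} {T : F[X][X]} {R : ℕ → F[X][X]}
    (hR : ∀ j, T.coeff j = ∑ i ∈ Finset.range g.natDegree, ((R i).coeff j).comp g * X ^ i)
    (hT : opEvalComp g f T = 0) {i : ℕ} (hi : i < g.natDegree) :
    opEval derivative' (R i) f = 0 := by
  refine eq_zero_of_sum_comp_mul_X_pow_eq_zero (q := fun i => opEval derivative' (R i) f) ?_ i hi
  rw [← hT]
  set N := T.natDegree + 1 + ∑ i ∈ Finset.range g.natDegree, (R i).natDegree with hN
  have h1 : opEvalComp g f T = ∑ j ∈ Finset.range N, T.coeff j * (derivative^[j] f).comp g := by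
    conv_lhs => rw [T.as_sum_range' N (by omega), map_sum]
    simp only [opEvalComp_monomial]
  have h2 : ∀ i ∈ Finset.range g.natDegree, opEval derivative' (R i) f =
      ∑ j ∈ Finset.range N, (R i).coeff j * derivative^[j] f := by
    intro i hi
    have := Finset.single_le_sum (f := fun i => (R i).natDegree) (fun _ _ => Nat.zero_le _) hi
    conv_lhs => rw [(R i).as_sum_range' N (by omega), map_sum, LinearMap.sum_apply]
    simp only [opEval_monomial]
    rfl
  rw [h1]
  simp only [hR, Finset.sum_mul]
  rw [Finset.sum_comm]
  refine Finset.sum_congr rfl fun i hi => ?_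
  rw [h2 i hi, Polynomial.sum_comp, Finset.sum_mul]
  refine Finset.sum_congr rfl fun j _ => ?_
  rw [mul_comp]
  ring

theorem map_aeval_eq_sum_rows {Ω : Type*} [Field Ω] [Algebra F Ω] [Algebra F[X] Ω] {x : Ω}
    (hx : ∀ p : F[X], algebraMap F[X] Ω p = aeval x (p.comp g)) {T : F[X][X]} {R : ℕ → F[X][X]}
    (hR : ∀ j, T.coeff j = ∑ i ∈ Finset.range g.natDegree, ((R i).coeff j).comp g * X ^ i) :
    T.map (aeval x : F[X] →ₐ[F] Ω).toRingHom =
      ∑ i ∈ Finset.range g.natDegree, C (x ^ i) * (R i).map (algebraMap F[X] Ω) := by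
  ext j
  rw [coeff_map, hR, finsetSum_coeff, map_sum]
  refine Finset.sum_congr rfl fun i _ => ?_
  rw [coeff_C_mul, coeff_map, hx, map_mul, map_pow]
  simp [mul_comm]

end Rows

section GenericRoot

variable {F K : Type*} [Field F] [Field K] [Algebra F K]

theorem exists_prod_aeval_roots_eq [IsAlgClosed F] [IsAlgClosed K] {g : F[X]}
    (hg : 0 < g.natDegree) (t : K) {v : F[X]} (hv : v ≠ 0) :
    ∃ q : F[X], q.natDegree = v.natDegree ∧
      (((g.map (algebraMap F K) - C t).roots.map fun y => aeval y v).prod = aeval t q) := by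
  set P : K[X] := g.map (algebraMap F K) - C t with hP
  have hPlead : P.leadingCoeff = algebraMap F K g.leadingCoeff := by
    rw [hP, leadingCoeff_sub_of_degree_lt, leadingCoeff_map]
    rw [degree_map]
    exact degree_C_le.trans_lt (natDegree_pos_iff_degree_pos.mp hg)
  have hlead : g.leadingCoeff ≠ 0 := by
    rw [Ne, leadingCoeff_eq_zero]
    exact ne_zero_of_natDegree_gt hg
  have hlinear : ∀ ρ : F, ∃ q : F[X], q.natDegree = 1 ∧
      ((P.roots.map fun y => aeval y (X - C ρ)).prod = aeval t q) := by
    intro ρ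
    set c : F := (-1) ^ P.roots.card / g.leadingCoeff with hc
    have hc0 : c ≠ 0 := div_ne_zero (pow_ne_zero _ (by simp)) hlead
    refine ⟨C (-c) * X + C (c * g.eval ρ), natDegree_linear (neg_ne_zero.mpr hc0), ?_⟩
    have h1 := (IsAlgClosed.splits P).eval_eq_prod_roots (algebraMap F K ρ)
    have h2 : (P.roots.map fun y => aeval y (X - C ρ)).prod =
        (-1) ^ P.roots.card * (P.roots.map fun y => algebraMap F K ρ - y).prod := by
      rw [← Multiset.card_map (fun y => algebraMap F K ρ - y), ← Multiset.prod_map_neg,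
        Multiset.map_map]
      simp
    have h3 : P.eval (algebraMap F K ρ) = algebraMap F K (g.eval ρ) - t := by
      rw [hP, eval_sub, eval_C, eval_map_algebraMap, aeval_algebraMap_apply_eq_algebraMap_eval]
    rw [h3, hPlead] at h1
    have h4 : algebraMap F K g.leadingCoeff ≠ 0 := by simpa using hlead
    rw [h2, hc]
    simp only [map_add, map_mul, map_neg, aeval_C, aeval_X, map_div₀, map_pow, map_one]
    field_simp
    linear_combination -h1
  have hmul : ∀ s : Multiset F, ∃ q : F[X], q.natDegree = s.card ∧ q ≠ 0 ∧
      ((P.roots.map fun y => aeval y (s.map (X - C ·)).prod).prod = aeval t q) := by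
    intro s
    induction s using Multiset.induction_on with
    | empty => exact ⟨1, by simp⟩
    | cons ρ s ih =>
      obtain ⟨q, hq, hq0, hqt⟩ := ih
      obtain ⟨q', hq', hqt'⟩ := hlinear ρ
      have hq'0 : q' ≠ 0 := ne_zero_of_natDegree_gt (n := 0) (by omega)
      refine ⟨q' * q, ?_, mul_ne_zero hq'0 hq0, ?_⟩
      · rw [natDegree_mul hq'0 hq0, hq, hq', Multiset.card_cons, add_comm]
      · simp only [Multiset.map_cons, Multiset.prod_cons, map_mul, Multiset.prod_map_mul] at hqt' ⊢
        rw [hqt, hqt']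
  obtain ⟨q, hq, -, hqt⟩ := hmul v.roots
  refine ⟨C (v.leadingCoeff ^ P.roots.card) * q, ?_, ?_⟩
  · rw [natDegree_C_mul (pow_ne_zero _ (leadingCoeff_ne_zero.mpr hv)), hq,
      IsAlgClosed.card_roots_eq_natDegree]
  · conv_lhs => rw [(IsAlgClosed.splits v).eq_prod_roots]
    simp only [map_mul, Multiset.prod_map_mul, aeval_C, hqt, map_pow]
    simp

variable [Algebra F[X] K] [IsScalarTower F F[X] K] {g : F[X]} {x : K}

theorem algebraMap_eq_aeval_comp (hx : algebraMap F[X] K X = aeval x g) (p : F[X]) :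
    algebraMap F[X] K p = aeval x (p.comp g) := by
  rw [aeval_comp, ← hx, aeval_algebraMap_apply, aeval_X_left_apply]

theorem transcendental_of_algebraMap_X_eq_aeval [IsAlgClosed F]
    (hinj : Function.Injective (algebraMap F[X] K)) (hx : algebraMap F[X] K X = aeval x g) :
    Transcendental F x := by
  intro h
  obtain ⟨c, rfl⟩ := minpoly.mem_range_of_degree_eq_one F x
    (IsAlgClosed.degree_eq_one_of_irreducible F (minpoly.irreducible h.isIntegral))
  rw [aeval_algebraMap_apply_eq_algebraMap_eval,
    IsScalarTower.algebraMap_apply F F[X] K] at hx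
  exact X_ne_C _ (hinj hx)

theorem exists_algEquiv_eq_of_aeval_eq {k : Type*} [Field k] [Algebra F k] [Algebra F[X] k]
    [IsFractionRing F[X] k] [Algebra k K] [IsScalarTower F k K] [IsScalarTower F[X] k K]
    [Normal k K] [IsScalarTower F F[X] k] [IsAlgClosed F]
    (hg : 0 < g.natDegree) (hx : algebraMap F[X] K X = aeval x g) {y : K}
    (hy : aeval y g = aeval x g) : ∃ σ : K ≃ₐ[k] K, σ x = y := by
  have hinj : Function.Injective (algebraMap F[X] K) := by
    rw [IsScalarTower.algebraMap_eq F[X] k K]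
    exact (algebraMap k K).injective.comp (IsFractionRing.injective F[X] k)
  have htr := transcendental_of_algebraMap_X_eq_aeval hinj hx
  have hint : IsIntegral k x := Algebra.IsIntegral.isIntegral x
  have hdeg : g.natDegree ≤ (minpoly k x).natDegree := by
    by_contra! hlt
    set p := IsLocalization.integerNormalization (nonZeroDivisors F[X]) (minpoly k x)
    have hp0 : p ≠ 0 := by
      rw [Ne, IsLocalization.integerNormalization_eq_zero_iff le_rfl]
      exact minpoly.ne_zero hint
    have hpx : aeval x p = 0 :=
      IsLocalization.integerNormalization_aeval_eq_zero _ _ (minpoly.aeval k x)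
    have hpdeg : p.natDegree < g.natDegree :=
      (natDegree_le_natDegree (degree_mono
        (IsLocalization.integerNormalization_support _ _))).trans_lt hlt
    rw [aeval_eq_sum_range' hpdeg] at hpx
    have h0 : ∑ i ∈ Finset.range g.natDegree, (p.coeff i).comp g * X ^ i = 0 := by
      refine (transcendental_iff.mp htr _ ?_)
      rw [map_sum, ← hpx]
      refine Finset.sum_congr rfl fun i _ => ?_
      rw [Algebra.smul_def, algebraMap_eq_aeval_comp hx, map_mul, map_pow, aeval_X]
    refine hp0 (Polynomial.ext fun i => ?_)
    rw [coeff_zero]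
    by_cases hi : i < g.natDegree
    · exact eq_zero_of_sum_comp_mul_X_pow_eq_zero h0 i hi
    · exact coeff_eq_zero_of_natDegree_lt (by omega)
  set P : k[X] := g.map (algebraMap F k) - C (algebraMap F[X] k X) with hP
  have hPy : ∀ z : K, aeval z P = aeval z g - aeval x g := by
    intro z
    rw [hP, map_sub, aeval_map_algebraMap, aeval_C, ← IsScalarTower.algebraMap_apply, hx]
  have hPdeg : P.natDegree = g.natDegree := by
    rw [hP, natDegree_sub_C, natDegree_map]
  obtain ⟨Q, hQ⟩ := minpoly.dvd k x (by rw [hPy, sub_self] : aeval x P = 0)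
  have hP0 : P ≠ 0 := ne_zero_of_natDegree_gt (n := 0) (by omega)
  have hQ0 : Q ≠ 0 := by rintro rfl; exact hP0 (by rw [hQ, mul_zero])
  have hQd : Q.natDegree = 0 := by
    have := natDegree_mul (minpoly.ne_zero hint) hQ0
    rw [← hQ, hPdeg] at this
    omega
  have hyP : aeval y P = 0 := by rw [hPy, hy, sub_self]
  rw [hQ, map_mul, mul_eq_zero] at hyP
  have hconj : IsConjRoot k x y := by
    refine isConjRoot_of_aeval_eq_zero hint (hyP.resolve_right ?_)
    rw [eq_C_of_natDegree_eq_zero hQd] at hQ0 ⊢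
    rw [aeval_C]
    simpa using hQ0
  obtain ⟨σ, hσ⟩ := isConjRoot_iff_exists_algEquiv.mp hconj.symm
  exact ⟨σ, hσ⟩

end GenericRoot

theorem exists_mem_natDegree_lt_of_linearIndependent {F : Type*} [Field F]
    {V : Submodule F F[X]} {N : ℕ} (hN : 0 < N) (hV : ∀ p ∈ V, p.natDegree ≤ N) {p q : F[X]}
    (hp : p ∈ V) (hq : q ∈ V) (hpq : LinearIndependent F ![p, q]) :
    ∃ v ∈ V, v ≠ 0 ∧ v.natDegree < N := by
  by_cases hlt : p.natDegree < N
  · exact ⟨p, hp, hpq.ne_zero 0, hlt⟩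
  have hpN : p.natDegree = N := (hV p hp).antisymm (not_lt.mp hlt)
  have hp0 : p.leadingCoeff ≠ 0 := leadingCoeff_ne_zero.mpr (hpq.ne_zero 0)
  have hmem : q.coeff N • p - p.leadingCoeff • q ∈ V :=
    V.sub_mem (V.smul_mem _ hp) (V.smul_mem _ hq)
  refine ⟨_, hmem, fun h => ?_, ?_⟩
  · have h2 := LinearIndependent.pair_iff.mp hpq (q.coeff N) (-p.leadingCoeff)
      (by rw [neg_smul, ← sub_eq_add_neg, h])
    exact hp0 (neg_eq_zero.mp h2.2)
  · refine (hV _ hmem).lt_of_ne fun h => ?_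
    have h2 : (q.coeff N • p - p.leadingCoeff • q).coeff N = 0 := by
      rw [coeff_sub, coeff_smul, coeff_smul, leadingCoeff, hpN]
      simp [mul_comm]
    nth_rewrite 2 [← h] at h2
    rw [← leadingCoeff, leadingCoeff_eq_zero] at h2
    rw [h2, natDegree_zero] at h
    omega

theorem exists_comp_or_eq_pow_add_C {F K : Type*} [Field F] [Field K] [Algebra F K] [IsAlgClosed F]
    [CharZero F] [IsAlgClosed K] {f g : F[X]} (hf : 0 < f.natDegree) (hg : 0 < g.natDegree) {x : K}
    (hx : Transcendental F x) {V : Submodule F F[X]}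
    (hV : ∀ p ∈ V, p.support ⊆ (f.comp g).support)
    (hconj : ∀ p ∈ V, p ≠ 0 → ∀ y : K, aeval y g = aeval x g →
      ∃ q ∈ V, q ≠ 0 ∧ aeval y p = aeval x q)
    {p q : F[X]} (hp : p ∈ V) (hq : q ∈ V) (hpq : LinearIndependent F ![p, q]) :
    (∃ (m : ℕ) (k : F[X]) (c : F), 2 ≤ m ∧ g = k ^ m + C c) ∨
      ∃ s : F[X], s ≠ 0 ∧ s.natDegree < f.natDegree ∧
        (s.comp g).support ⊆ (f.comp g).support := by
  have hN : 0 < (f.comp g).natDegree := by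
    rw [natDegree_comp]
    exact Nat.mul_pos hf hg
  obtain ⟨v₀, hv₀⟩ := exists_mem_natDegree_lt_of_linearIndependent hN
    (fun p hp => natDegree_le_natDegree (degree_mono (hV p hp))) hp hq hpq
  obtain ⟨v, ⟨hvV, hv0⟩, hvmin⟩ := WellFounded.has_min
    (InvImage.wf (natDegree (R := F)) wellFounded_lt) {v : F[X] | v ∈ V ∧ v ≠ 0}
    ⟨v₀, hv₀.1, hv₀.2.1⟩
  have hmin : ∀ w ∈ V, w ≠ 0 → v.natDegree ≤ w.natDegree := fun w hw hw0 =>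
    not_lt.mp (hvmin w ⟨hw, hw0⟩)
  have hvN : v.natDegree < (f.comp g).natDegree := (hmin v₀ hv₀.1 hv₀.2.1).trans_lt hv₀.2.2
  set P : K[X] := g.map (algebraMap F K) - C (aeval x g) with hP
  have hPdeg : P.natDegree = g.natDegree := by rw [hP, natDegree_sub_C, natDegree_map]
  have hroot : ∀ y ∈ P.roots, aeval y g = aeval x g := by
    intro y hy
    have := (mem_roots'.mp hy).2
    rwa [hP, IsRoot.def, eval_sub, eval_C, eval_map_algebraMap, sub_eq_zero] at this
  obtain ⟨r, hr, hrprod⟩ := exists_prod_aeval_roots_eq (K := K) hg (aeval x g) hv0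
  have hprod : ∀ s : Multiset K, s ≤ P.roots → ∃ w : F[X], w ≠ 0 ∧
      (s.map fun y => aeval y v).prod = aeval x w ∧ s.card * v.natDegree ≤ w.natDegree ∧
      (w.natDegree ≤ s.card * v.natDegree → ∃ c : F, w = C c * v ^ s.card) := by
    intro s hs
    induction s using Multiset.induction_on with
    | empty => exact ⟨1, one_ne_zero, by simp, by simp, fun _ => ⟨1, by simp⟩⟩
    | cons y s ih =>
      obtain ⟨w, hw0, hwprod, hwle, hw⟩ := ih ((Multiset.le_cons_self s y).trans hs)
      obtain ⟨u, huV, hu0, hu⟩ := hconj v hvV hv0 y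
        (hroot y (Multiset.mem_of_le hs (Multiset.mem_cons_self y s)))
      have hu1 := hmin u huV hu0
      rw [Multiset.card_cons, add_mul, one_mul]
      refine ⟨u * w, mul_ne_zero hu0 hw0, ?_, ?_, fun hle => ?_⟩
      · rw [Multiset.map_cons, Multiset.prod_cons, hwprod, hu, map_mul]
      · rw [natDegree_mul hu0 hw0]
        omega
      · rw [natDegree_mul hu0 hw0] at hle
        obtain ⟨c, hc⟩ := hw (by omega)
        have hmem : u - (u.leadingCoeff / v.leadingCoeff) • v ∈ V :=
          V.sub_mem huV (V.smul_mem _ hvV)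
        have hlc : u.leadingCoeff / v.leadingCoeff ≠ 0 :=
          div_ne_zero (leadingCoeff_ne_zero.mpr hu0) (leadingCoeff_ne_zero.mpr hv0)
        have hzero : u - (u.leadingCoeff / v.leadingCoeff) • v = 0 := by
          by_contra hne
          refine (hmin _ hmem hne).not_gt (natDegree_lt_natDegree hne ?_)
          have hdeg : u.degree = v.degree := by
            rw [degree_eq_natDegree hu0, degree_eq_natDegree hv0]
            congr 1
            omega
          rw [← hdeg, smul_eq_C_mul]
          refine degree_sub_lt_left ?_ hu0 ?_
          · rw [degree_C_mul hlc, hdeg]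
          · rw [leadingCoeff_mul, leadingCoeff_C,
              div_mul_cancel₀ _ (leadingCoeff_ne_zero.mpr hv0)]
        refine ⟨u.leadingCoeff / v.leadingCoeff * c, ?_⟩
        rw [hc, sub_eq_zero.mp hzero, smul_eq_C_mul, pow_succ, C_mul, leadingCoeff_mul,
          leadingCoeff_C, div_mul_cancel₀ _ (leadingCoeff_ne_zero.mpr hv0)]
        ring
  obtain ⟨w, hw0, hwprod, -, hw⟩ := hprod P.roots le_rfl
  rw [IsAlgClosed.card_roots_eq_natDegree, hPdeg] at hw
  have hwr : w = r.comp g := by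
    rw [← sub_eq_zero]
    refine transcendental_iff.mp hx _ ?_
    rw [map_sub, aeval_comp, ← hrprod, ← hwprod, sub_self]
  obtain ⟨c, hc⟩ := hw (by rw [hwr, natDegree_comp, hr, mul_comm])
  have hc0 : c ≠ 0 := by
    rintro rfl
    exact hw0 (by rw [hc, C_0, zero_mul])
  have hpow : v ^ g.natDegree = (C c⁻¹ * r).comp g := by
    rw [mul_comp, C_comp, ← hwr, hc, ← mul_assoc, ← C_mul, inv_mul_cancel₀ hc0, C_1, one_mul]
  refine (exists_comp_of_pow_eq_comp hg hv0 hpow).symm.imp id ?_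
  rintro ⟨s, rfl⟩
  refine ⟨s, ?_, ?_, hV _ hvV⟩
  · rintro rfl
    exact hv0 zero_comp
  · rw [natDegree_comp, natDegree_comp] at hvN
    exact lt_of_mul_lt_mul_right hvN (Nat.zero_le _)

theorem map_opComp {R A B : Type*} [CommRing R] [CommRing A] [CommRing B] [Algebra R A]
    [Algebra R B] {δ : Derivation R A A} {δ' : Derivation R B B} {φ : A →+* B}
    (h : ∀ a, φ (δ a) = δ' (φ a)) (G T : A[X]) :
    (opComp δ G T).map φ = opComp δ' (G.map φ) (T.map φ) := by
  induction T using Polynomial.induction_on' with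
  | add p q hp hq => simp [hp, hq]
  | monomial j a =>
    rw [map_monomial, opComp_monomial, opComp_monomial, Polynomial.map_mul, map_C,
      map_iterate_opDeriv h]

theorem natDegree_le_one_of_rows_mem_span {F k : Type*} [Field F] [IsAlgClosed F] [CharZero F]
    [Field k] [Algebra F[X] k] [IsFractionRing F[X] k] [Algebra F k] [IsScalarTower F F[X] k]
    {f g : F[X]} (hf : 0 < f.natDegree) (hg : 0 < g.natDegree)
    (hpow : ¬ ∃ (m : ℕ) (k : F[X]) (c : F), 2 ≤ m ∧ g = k ^ m + C c)
    (hmin : ∀ s : F[X], s ≠ 0 → s.natDegree < f.natDegree →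
      ¬ (s.comp g).support ⊆ (f.comp g).support)
    {δ : Derivation F k k}
    (hδ : ∀ p : F[X], algebraMap F[X] k (derivative p) = δ (algebraMap F[X] k p))
    {R : ℕ → F[X][X]}
    (hR : ∀ j, (eulerAnnihilator g (f.comp g).support.toList).coeff j =
      ∑ i ∈ Finset.range g.natDegree, ((R i).coeff j).comp g * X ^ i)
    {G : k[X]} (hG : ∀ i < g.natDegree, (R i).map (algebraMap F[X] k) ∈
      Submodule.span k (Set.range fun a => (opDeriv δ)^[a] G)) : G.natDegree ≤ 1 := by
  classical
  by_contra! hG2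
  have hG0 : G ≠ 0 := ne_zero_of_natDegree_gt hG2
  set E := (f.comp g).support with hE
  have : CharZero k := charZero_of_injective_algebraMap (algebraMap F k).injective
  let K := AlgebraicClosure k
  have : Algebra.FormallyEtale k K := Algebra.FormallyEtale.of_isSeparable k K
  obtain ⟨δ', hδ'⟩ := exists_derivation_extension (R := F) (S := k) (T := K) δ
  have hconst : ∀ u, δ' u = 0 → u ∈ (algebraMap F K).range := fun u hu =>
    mem_range_of_derivation_eq_zero hδ'
      (fun _ h => mem_range_of_fractionRing_derivation_eq_zero hδ h) hu
  have hinj : Function.Injective (algebraMap F[X] K) := by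
    rw [IsScalarTower.algebraMap_eq F[X] k K]
    exact (algebraMap k K).injective.comp (IsFractionRing.injective F[X] k)
  obtain ⟨x, hx⟩ : ∃ x : K, algebraMap F[X] K X = aeval x g := by
    obtain ⟨x, hx⟩ := IsAlgClosed.exists_root
      (g.map (algebraMap F K) - C (algebraMap F[X] K X)) (by
        refine (natDegree_pos_iff_degree_pos.mp ?_).ne'
        rwa [natDegree_sub_C, natDegree_map])
    rw [IsRoot.def, eval_sub, eval_C, eval_map_algebraMap, sub_eq_zero] at hx
    exact ⟨x, hx.symm⟩
  have htr := transcendental_of_algebraMap_X_eq_aeval hinj hx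
  have hxδ : aeval x (derivative g) * δ' x = 1 := by
    rw [← smul_eq_mul, ← Derivation.map_aeval, ← hx, IsScalarTower.algebraMap_apply F[X] k K,
      ← hδ', ← hδ, derivative_X, map_one, map_one]
  set L : K[X] := (eulerAnnihilator g E.toList).map (aeval x : F[X] →ₐ[F] K).toRingHom with hL
  set G' : K[X] := G.map (algebraMap k K) with hG'
  have hG'0 : G' ≠ 0 := by rwa [hG', Ne, Polynomial.map_eq_zero]
  obtain ⟨A, hA⟩ : ∃ A, opComp δ' G' A = L := by
    rw [hL, map_aeval_eq_sum_rows (algebraMap_eq_aeval_comp hx) hR]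
    rw [← LinearMap.mem_range]
    refine Submodule.sum_mem _ fun i hi => ?_
    rw [← smul_eq_C_mul]
    refine Submodule.smul_mem _ _ ?_
    obtain ⟨S, hS⟩ := exists_opComp_eq_of_mem_span δ (hG i (Finset.mem_range.mp hi))
    refine ⟨S.map (algebraMap k K), ?_⟩
    rw [hG', ← map_opComp hδ', hS, Polynomial.map_map, ← IsScalarTower.algebraMap_eq]
  have hLle : L.natDegree ≤ E.card := by
    rw [← Finset.length_toList]
    exact natDegree_map_le.trans (natDegree_eulerAnnihilator_le _ _)
  have hLcoeff : L.coeff E.card ≠ 0 := by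
    rw [hL, coeff_map, ← Finset.length_toList, coeff_eulerAnnihilator_length, map_pow]
    refine pow_ne_zero _ ?_
    have : aeval x (derivative g) ≠ 0 := left_ne_zero_of_mul_eq_one hxδ
    have hx0 : x ≠ 0 := fun h => htr (h ▸ isAlgebraic_zero)
    change aeval x (X * derivative g) ≠ 0
    rw [map_mul, aeval_X]
    exact mul_ne_zero hx0 this
  have hL0 : L ≠ 0 := by
    intro h
    rw [h, coeff_zero] at hLcoeff
    exact hLcoeff rfl
  have hLdeg : L.natDegree = E.card := hLle.antisymm (le_natDegree_of_ne_zero hLcoeff)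
  have hA0 : A ≠ 0 := by
    rintro rfl
    exact hL0 (by rw [← hA, map_zero])
  have hdeg : A.natDegree + G.natDegree = E.card := by
    rw [← hLdeg, ← hA, natDegree_opComp δ' hG'0 hA0, hG', natDegree_map]
  set b : E → F[X] := fun e => monomial e 1 with hb
  have hbli : LinearIndependent F b := by
    have := (basisMonomials F).linearIndependent.comp (Subtype.val : E → ℕ)
      Subtype.val_injective
    convert this using 1
    ext1 e
    simp [hb]
  set PE : Submodule F F[X] := Submodule.span F (Set.range b) with hPE
  have : FiniteDimensional F PE := FiniteDimensional.span_of_finite F (Set.finite_range b)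
  have hPEdim : Module.finrank F PE = E.card := by
    rw [hPE, finrank_span_eq_card hbli, Fintype.card_coe]
  have hPEsupp : ∀ p ∈ PE, p.support ⊆ E := by
    intro p hp
    induction hp using Submodule.span_induction with
    | mem p hp =>
      obtain ⟨e, rfl⟩ := hp
      exact (support_monomial_subset _ _).trans (Finset.singleton_subset_iff.mpr e.2)
    | zero => simp
    | add p q _ _ hp hq => exact support_add.trans (Finset.union_subset hp hq)
    | smul c p _ hp => exact (support_smul _ _).trans hp
  set ev : F[X] →ₗ[F] K := (aeval x : F[X] →ₐ[F] K).toLinearMap with hev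
  have hevinj : Function.Injective ev := transcendental_iff_injective.mp htr
  have hle : PE.map ev ≤ LinearMap.ker (opEval δ' L) := by
    rw [hPE, Submodule.map_span, Submodule.span_le]
    rintro _ ⟨_, ⟨e, rfl⟩, rfl⟩
    have : ev (b e) = x ^ (e : ℕ) := by simp [hev, hb, aeval_monomial]
    rw [SetLike.mem_coe, LinearMap.mem_ker, this, opEval_eulerAnnihilator_pow g hxδ]
    refine mul_eq_zero_of_left (List.prod_eq_zero ?_) _
    exact List.mem_map.mpr ⟨e, Finset.mem_toList.mpr e.2, sub_self _⟩
  have hker : LinearMap.ker (opEval δ' L) ≤ PE.map ev := by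
    intro u hu
    have h1 : PE.map ev ⊔ Submodule.span F {u} ≤ LinearMap.ker (opEval δ' L) :=
      sup_le hle ((Submodule.span_singleton_le_iff_mem _ _).mpr hu)
    have h2 := finrank_le_natDegree_of_le_ker_opEval δ' hconst hL0 _ h1
    have h3 : PE.map ev = PE.map ev ⊔ Submodule.span F {u} := by
      refine Submodule.eq_of_le_of_finrank_le le_sup_left (h2.trans ?_)
      rw [hLdeg, (PE.equivMapOfInjective ev hevinj).symm.finrank_eq, hPEdim]
    rw [h3]
    exact Submodule.mem_sup_right (Submodule.mem_span_singleton_self u)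
  have hkerG : LinearMap.ker (opEval δ' G') ≤ LinearMap.ker (opEval δ' L) := by
    intro u hu
    rw [LinearMap.mem_ker] at hu ⊢
    rw [← hA, opEval_opComp, hu, map_zero]
  set T := (opEval δ' G' ∘ₗ ev).domRestrict PE with hT
  have hrange : Module.finrank F (LinearMap.range T) ≤ A.natDegree := by
    refine finrank_le_natDegree_of_le_ker_opEval δ' hconst hA0 _ ?_
    rintro _ ⟨⟨p, hp⟩, rfl⟩
    rw [hT, LinearMap.mem_ker, LinearMap.domRestrict_apply, LinearMap.comp_apply,
      ← opEval_opComp, hA]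
    exact hle (Submodule.mem_map_of_mem hp)
  have hkerT : 1 < Module.finrank F (LinearMap.ker T) := by
    have := LinearMap.finrank_range_add_finrank_ker T
    omega
  set V : Submodule F F[X] := PE ⊓ LinearMap.ker (opEval δ' G' ∘ₗ ev) with hV
  obtain ⟨p, q, hp, hq, hpq⟩ : ∃ p q, p ∈ V ∧ q ∈ V ∧ LinearIndependent F ![p, q] := by
    obtain ⟨u, hu⟩ := (Module.finrank_pos_iff_exists_ne_zero (R := F) (M := LinearMap.ker T)).mp
      (zero_lt_one.trans hkerT)
    obtain ⟨w, hw⟩ := exists_linearIndependent_pair_of_one_lt_finrank hkerT hu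
    refine ⟨u, w, ⟨u.1.2, u.2⟩, ⟨w.1.2, w.2⟩, ?_⟩
    refine LinearIndependent.pair_iff.mpr fun s t hst =>
      LinearIndependent.pair_iff.mp hw s t (Subtype.ext (Subtype.ext hst))
  have hconj : ∀ p ∈ V, p ≠ 0 → ∀ y : K, aeval y g = aeval x g →
      ∃ q ∈ V, q ≠ 0 ∧ aeval y p = aeval x q := by
    intro p hp hp0 y hy
    obtain ⟨σ, hσ⟩ := exists_algEquiv_eq_of_aeval_eq (k := k) hg hx hy
    have hyp : aeval y p = σ (ev p) := by
      rw [← hσ]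
      exact aeval_algHom_apply (σ.toAlgHom.restrictScalars F) x p
    have hy0 : opEval δ' G' (aeval y p) = 0 := by
      have h1 := opEval_map (φ := (σ : K →+* K)) (δ := δ') (δ' := δ')
        (fun a => derivation_commute_algEquiv hδ' σ a) G' (ev p)
      have h2 : G'.map (σ : K →+* K) = G' := by
        rw [hG', Polynomial.map_map]
        congr 1
        ext a
        simp
      have h3 : opEval δ' G' (ev p) = 0 := hp.2
      rw [h2, h3, map_zero] at h1
      rw [hyp]
      exact h1
    obtain ⟨q, hq, hqy⟩ := hker (hkerG hy0)
    refine ⟨q, ⟨hq, ?_⟩, ?_, hqy.symm⟩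
    · rw [SetLike.mem_coe, LinearMap.mem_ker, LinearMap.comp_apply, hqy, hy0]
    · rintro rfl
      rw [map_zero, hyp, eq_comm, map_eq_zero, ← map_zero ev] at hqy
      exact hp0 (hevinj hqy)
  rcases exists_comp_or_eq_pow_add_C hf hg htr (V := V) (fun p hp => hPEsupp p hp.1) hconj hp hq hpq
    with h | ⟨s, hs0, hs, hsupp⟩
  · exact hpow h
  · exact hmin s hs0 hs hsupp

section Stages

variable {F k : Type*} [Field F] [Field k] [Algebra F k] (δ : Derivation F k k)

theorem opComp_ne_zero {G T : k[X]} (hG : G ≠ 0) (hT : T ≠ 0) : opComp δ G T ≠ 0 := by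
  intro h
  have h1 := natDegree_opComp δ hG hT
  rw [h, natDegree_zero] at h1
  obtain ⟨a, rfl⟩ := natDegree_eq_zero.mp (show T.natDegree = 0 by omega)
  rw [← monomial_zero_left, opComp_monomial] at h
  exact mul_ne_zero hT hG h

theorem finrank_degreeLT_map_opComp {G : k[X]} (hG : G ≠ 0) (m : ℕ) :
    Module.finrank k ((degreeLT k m).map (opComp δ G)) = m := by
  have hinj : Function.Injective (opComp δ G) :=
    (injective_iff_map_eq_zero _).mpr fun T h => by_contra fun hT => opComp_ne_zero δ hG hT h
  rw [← ((degreeLT k m).equivMapOfInjective _ hinj).finrank_eq, (degreeLTEquiv k m).finrank_eq,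
    Module.finrank_fin_fun]

theorem degreeLT_map_opComp_le {G : k[X]} {m : ℕ} {M : Submodule k k[X]}
    (h : ∀ a < m, (opDeriv δ)^[a] G ∈ M) : (degreeLT k m).map (opComp δ G) ≤ M := by
  classical
  rw [degreeLT_eq_span_X_pow, Submodule.map_span, Submodule.span_le]
  rintro _ ⟨_, hT, rfl⟩
  obtain ⟨a, ha, rfl⟩ := Finset.mem_image.mp (Finset.mem_coe.mp hT)
  rw [SetLike.mem_coe, X_pow_eq_monomial, opComp_monomial, C_1, one_mul]
  exact h a (Finset.mem_range.mp ha)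

theorem exists_eq_degreeLT_map_opComp {M M' : Submodule k k[X]} [FiniteDimensional k M'] {N : ℕ}
    (hM : M ≠ ⊥) (hMM' : M ≤ M') (hN : ∀ p ∈ M, p.natDegree ≤ N)
    (hD : ∀ p ∈ M, opDeriv δ p ∈ M') (htop : ∃ q ∈ M', N < q.natDegree)
    (hrank : Module.finrank k M' ≤ Module.finrank k M + 1) :
    ∃ G ∈ M, G ≠ 0 ∧ M = (degreeLT k (N + 1 - G.natDegree)).map (opComp δ G) := by
  have hclosed : ∀ p ∈ M', p.natDegree ≤ N → p ∈ M := by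
    intro p hp hpN
    set W : Submodule k k[X] := M' ⊓ degreeLE k N with hW
    have hWmem : ∀ q, q ∈ W ↔ q ∈ M' ∧ q.natDegree ≤ N := fun q => by
      rw [hW, Submodule.mem_inf, mem_degreeLE, natDegree_le_iff_degree_le]
    have hMW : M ≤ W := fun q hq => (hWmem q).mpr ⟨hMM' hq, hN q hq⟩
    have : FiniteDimensional k W := Submodule.finiteDimensional_of_le (inf_le_left : W ≤ M')
    have hlt : Module.finrank k W < Module.finrank k M' := by
      refine Submodule.finrank_lt_finrank_of_lt (lt_of_le_of_ne inf_le_left fun h => ?_)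
      obtain ⟨q, hq, hqN⟩ := htop
      rw [← h, hWmem] at hq
      omega
    rw [Submodule.eq_of_le_of_finrank_le hMW (by omega), hWmem]
    exact ⟨hp, hpN⟩
  classical
  have hex : ∃ r, ∃ p ∈ M, p ≠ 0 ∧ p.natDegree = r := by
    obtain ⟨p, hp, hp0⟩ := M.ne_bot_iff.mp hM
    exact ⟨_, p, hp, hp0, rfl⟩
  obtain ⟨G, hG, hG0, hGr⟩ := Nat.find_spec hex
  have hmin : ∀ p ∈ M, p.natDegree < G.natDegree → p = 0 := fun p hp hpr => by
    by_contra hp0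
    exact Nat.find_min hex (hGr ▸ hpr) ⟨p, hp, hp0, rfl⟩
  have hle : (degreeLT k (N + 1 - G.natDegree)).map (opComp δ G) ≤ M := by
    refine degreeLT_map_opComp_le δ fun a ha => ?_
    induction a with
    | zero => exact hG
    | succ a ih =>
      rw [Function.iterate_succ_apply']
      refine hclosed _ (hD _ (ih (by omega))) ?_
      rw [natDegree_opDeriv δ (iterate_opDeriv_ne_zero δ hG0 a), natDegree_iterate_opDeriv δ hG0]
      omega
  refine ⟨G, hG, hG0, le_antisymm (fun p hp => ?_) hle⟩
  obtain ⟨S, U, rfl, hU⟩ := exists_opComp_add δ hG0 p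
  have hS : opComp δ G S ∈ (degreeLT k (N + 1 - G.natDegree)).map (opComp δ G) := by
    refine Submodule.mem_map_of_mem (mem_degreeLT.mpr ?_)
    by_cases hS0 : S = 0
    · rw [hS0, degree_zero]
      exact WithBot.bot_lt_coe _
    have h1 := natDegree_opComp δ hG0 hS0
    have h2 : U.degree < (opComp δ G S).degree := by
      refine hU.trans_le ?_
      rw [degree_eq_natDegree hG0, degree_eq_natDegree (opComp_ne_zero δ hG0 hS0), h1]
      exact_mod_cast Nat.le_add_left _ _
    have h3 := hN _ hp
    rw [natDegree_add_eq_left_of_degree_lt h2, h1] at h3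
    rw [degree_eq_natDegree hS0]
    exact_mod_cast (by omega : S.natDegree < N + 1 - G.natDegree)
  have hUM : U ∈ M := (Submodule.add_mem_iff_right _ (hle hS)).mp hp
  have hU0 : U = 0 := by
    by_contra hU0
    exact hU0 (hmin U hUM (natDegree_lt_natDegree hU0 hU))
  rwa [hU0, add_zero]

end Stages

theorem exists_finset_linearIndepOn_extension {ι K V : Type*} [DivisionRing K] [AddCommGroup V]
    [Module K V] {v : ι → V} {A : Finset ι} {T : Set ι} (hA : LinearIndepOn K v (A : Set ι))
    (hAT : (A : Set ι) ⊆ T) (hT : T.Finite) :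
    ∃ B : Finset ι, A ⊆ B ∧ (B : Set ι) ⊆ T ∧ LinearIndepOn K v (B : Set ι) ∧
      Submodule.span K (v '' B) = Submodule.span K (v '' T) := by
  obtain ⟨b, hbT, hAb, hspan, hb⟩ := exists_linearIndepOn_extension hA hAT
  refine ⟨(hT.subset hbT).toFinset, ?_, ?_, ?_, ?_⟩
  · intro i hi
    simpa using hAb hi
  · simpa using hbT
  · simpa using hb
  · rw [Set.Finite.coe_toFinset]
    exact (Submodule.span_mono (Set.image_mono hbT)).antisymm (Submodule.span_le.mpr hspan)

theorem finrank_span_image_eq_card {ι K V : Type*} [DivisionRing K] [AddCommGroup V]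
    [Module K V] {v : ι → V} {B : Finset ι} (hB : LinearIndepOn K v (B : Set ι)) :
    Module.finrank K (Submodule.span K (v '' B)) = B.card := by
  have := finrank_span_eq_card hB
  rw [Set.image_eq_range]
  simpa using this

theorem card_mul_le_sum_weight {s : ℕ} {C : Finset (ℕ × ℕ)} (hC : ∀ x ∈ C, x.1 = s) :
    C.card * (s + 1) ≤ ∑ x ∈ C, (x.1 + if x.2 = 0 then 0 else 1) + 1 := by
  have h1 : ∑ x ∈ C, (if (s, 0) = x then 1 else 0) ≤ 1 := by
    rw [Finset.sum_ite_eq]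
    split_ifs <;> simp
  calc C.card * (s + 1) = ∑ x ∈ C, ((x.1 + if x.2 = 0 then 0 else 1) +
      if (s, 0) = x then 1 else 0) := by
        rw [← smul_eq_mul, ← Finset.sum_const]
        refine Finset.sum_congr rfl fun x hx => ?_
        obtain ⟨a, i⟩ := x
        obtain rfl : a = s := hC _ hx
        by_cases hi : i = 0 <;> simp [hi, eq_comm]
    _ ≤ _ := by
      rw [Finset.sum_add_distrib]
      omega

theorem exists_independent_rows {F k : Type*} [Field F] [Field k] [Algebra F k]
    (δ : Derivation F k k) {R : ℕ → k[X]} {n ℓ : ℕ} (hℓ : 2 ≤ ℓ)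
    (hdeg : ∀ i < n, (R i).natDegree ≤ ℓ) (htop : ∃ i < n, (R i).natDegree = ℓ)
    (hconst : ∀ c : k, c ≠ 0 → C c ∉ Submodule.span k
      ((fun x : ℕ × ℕ => (opDeriv δ)^[x.1] (R x.2)) '' {x | x.2 < n}))
    (hkey : ∀ G : k[X], (∀ i < n, R i ∈ Submodule.span k (Set.range fun a => (opDeriv δ)^[a] G)) →
      G.natDegree ≤ 1) :
    ∃ B : Finset (ℕ × ℕ), ℓ ≤ B.card ∧ (∀ x ∈ B, x.2 < n ∧ ℓ + x.1 ≤ B.card) ∧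
      LinearIndepOn k (fun x : ℕ × ℕ => (opDeriv δ)^[x.1] (R x.2)) (B : Set (ℕ × ℕ)) ∧
      B.card * (B.card + 1) ≤
        2 * ∑ x ∈ B, (x.1 + if x.2 = 0 then 0 else 1) + 2 * (ℓ * (ℓ - 1)) := by
  by_contra hcon
  set v : ℕ × ℕ → k[X] := fun x => (opDeriv δ)^[x.1] (R x.2) with hv
  set w : ℕ × ℕ → ℕ := fun x => x.1 + if x.2 = 0 then 0 else 1 with hw
  set T : ℕ → Set (ℕ × ℕ) := fun s => {x | x.1 ≤ s ∧ x.2 < n} with hT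
  set M : ℕ → Submodule k k[X] := fun s => Submodule.span k (v '' T s) with hM
  have hTfin : ∀ s, (T s).Finite := fun s => by
    refine ((Finset.range (s + 1) ×ˢ Finset.range n).finite_toSet).subset fun x hx => ?_
    simpa [Nat.lt_succ_iff, hT] using hx
  have hTmono : ∀ {s t}, s ≤ t → T s ⊆ T t := fun h x hx => ⟨hx.1.trans h, hx.2⟩
  have hMfin : ∀ s, FiniteDimensional k (M s) := fun s =>
    FiniteDimensional.span_of_finite k ((hTfin s).image v)
  have hvM : ∀ {s x}, x ∈ T s → v x ∈ M s := fun hx =>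
    Submodule.subset_span (Set.mem_image_of_mem v hx)
  have hMdeg : ∀ s, ∀ p ∈ M s, p.natDegree ≤ ℓ + s := by
    intro s p hp
    have : M s ≤ degreeLE k (ℓ + s : ℕ) := by
      refine Submodule.span_le.mpr ?_
      rintro _ ⟨x, hx, rfl⟩
      rw [SetLike.mem_coe, mem_degreeLE, ← natDegree_le_iff_degree_le]
      exact (natDegree_iterate_opDeriv_le δ _ _).trans (Nat.add_le_add (hdeg _ hx.2) hx.1)
    rw [natDegree_le_iff_degree_le]
    exact mem_degreeLE.mp (this hp)
  have hMD : ∀ s, ∀ p ∈ M s, opDeriv δ p ∈ M (s + 1) := by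
    intro s p hp
    induction hp using Submodule.span_induction with
    | mem p hp =>
      obtain ⟨x, hx, rfl⟩ := hp
      rw [← Function.iterate_succ_apply' (opDeriv δ)]
      exact hvM (x := (x.1 + 1, x.2)) ⟨Nat.succ_le_succ hx.1, hx.2⟩
    | zero => simp
    | add p q _ _ hp hq => rw [map_add]; exact add_mem hp hq
    | smul c p hp' hp =>
      rw [smul_eq_C_mul, opDeriv_C_mul, ← smul_eq_C_mul, ← smul_eq_C_mul]
      exact add_mem (Submodule.smul_mem _ _ (Submodule.span_mono
        (Set.image_mono (hTmono s.le_succ)) hp')) (Submodule.smul_mem _ _ hp)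
  have hMpos : ∀ s, ∀ p ∈ M s, p ≠ 0 → 0 < p.natDegree := by
    intro s p hp hp0
    rw [Nat.pos_iff_ne_zero]
    intro h
    obtain ⟨c, rfl⟩ := natDegree_eq_zero.mp h
    refine hconst c (fun hc => hp0 (by rw [hc, C_0])) (Submodule.span_mono (Set.image_mono ?_) hp)
    exact fun x hx => hx.2
  obtain ⟨i₀, hi₀, hi₀ℓ⟩ := htop
  have hRi₀ : R i₀ ≠ 0 := ne_zero_of_natDegree_gt (n := 0) (by omega)
  have hrank : ∀ s, Module.finrank k (M s) ≤ ℓ + s + 1 := by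
    intro s
    have h1 : M s ≤ degreeLT k (ℓ + s + 1) := fun p hp => by
      rw [mem_degreeLT]
      exact (natDegree_le_iff_degree_le.mp (hMdeg s p hp)).trans_lt (by exact_mod_cast Nat.lt_succ_self _)
    have : FiniteDimensional k (degreeLT k (ℓ + s + 1)) :=
      Module.Finite.equiv (degreeLTEquiv k (ℓ + s + 1)).symm
    refine (Submodule.finrank_mono h1).trans_eq ?_
    rw [(degreeLTEquiv k _).finrank_eq, Module.finrank_fin_fun]
  have hstage : ∀ s, ∃ B : Finset (ℕ × ℕ), (B : Set (ℕ × ℕ)) ⊆ T s ∧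
      LinearIndepOn k v (B : Set (ℕ × ℕ)) ∧ Submodule.span k (v '' B) = M s ∧
      2 * (s + 1) ≤ B.card ∧ s * (s + 1) + B.card ≤ ∑ x ∈ B, w x + (s + 1) := by
    intro s
    induction s with
    | zero =>
      obtain ⟨B, -, hBT, hB, hspan⟩ := exists_finset_linearIndepOn_extension (K := k) (v := v) (A := ∅)
        (by simp) (by simp) (hTfin 0)
      refine ⟨B, hBT, hB, hspan, ?_, ?_⟩
      · by_contra! hcard
        have h0 : Module.finrank k (M 0) = B.card := by
          rw [← finrank_span_image_eq_card hB, hspan]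
        have h1 : Submodule.span k {R i₀} = M 0 := by
          refine Submodule.eq_of_le_of_finrank_le ((Submodule.span_singleton_le_iff_mem _ _).mpr
            (hvM (x := (0, i₀)) ⟨le_rfl, hi₀⟩)) ?_
          rw [finrank_span_singleton hRi₀]
          omega
        have h2 := hkey (R i₀) fun i hi => by
          have h3 : R i ∈ M 0 := hvM (x := (0, i)) ⟨le_rfl, hi⟩
          rw [← h1] at h3
          exact Submodule.span_mono (Set.singleton_subset_iff.mpr (Set.mem_range.mpr ⟨0, rfl⟩)) h3
        omega
      · have := card_mul_le_sum_weight (s := 0) (C := B) fun x hx => Nat.le_zero.mp (hBT hx).1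
        simpa using this
    | succ s ih =>
      obtain ⟨A, hAT, hA, hAspan, hAcard, hAsum⟩ := ih
      obtain ⟨B, hAB, hBT, hB, hspan⟩ := exists_finset_linearIndepOn_extension hA
        (hAT.trans (hTmono s.le_succ)) (hTfin (s + 1))
      have hnew : ∀ x ∈ B \ A, x.1 = s + 1 := by
        intro x hx
        obtain ⟨hxB, hxA⟩ := Finset.mem_sdiff.mp hx
        refine (hBT hxB).1.antisymm ?_
        by_contra! hlt
        have h1 : v x ∈ Submodule.span k (v '' A) := by
          rw [hAspan]
          exact hvM ⟨Nat.lt_succ_iff.mp hlt, (hBT hxB).2⟩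
        refine ((linearIndepOn_insert (by simpa using hxA)).mp (hB.mono ?_)).2 h1
        exact Set.insert_subset hxB (Finset.coe_subset.mpr hAB)
      have h1 : _ ≤ ∑ x ∈ B \ A, w x + 1 := card_mul_le_sum_weight hnew
      have h2 := Finset.sum_sdiff (f := w) hAB
      have h3 := Finset.card_sdiff_add_card_eq_card hAB
      by_cases hm : 2 ≤ (B \ A).card
      · refine ⟨B, hBT, hB, hspan, by omega, ?_⟩
        have : 2 * (s + 1) ≤ (B \ A).card * (s + 1) := Nat.mul_le_mul_right _ hm
        nlinarith
      exfalso
      obtain ⟨G, hG, hG0, hMG⟩ := exists_eq_degreeLT_map_opComp δ (M := M s) (M' := M (s + 1))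
        (N := ℓ + s) ((Submodule.ne_bot_iff _).mpr ⟨R i₀, hvM (x := (0, i₀)) ⟨s.zero_le, hi₀⟩, hRi₀⟩)
        (Submodule.span_mono (Set.image_mono (hTmono s.le_succ))) (hMdeg s) (hMD s)
        ⟨(opDeriv δ)^[s + 1] (R i₀), hvM (x := (s + 1, i₀)) ⟨le_rfl, hi₀⟩, by
          rw [natDegree_iterate_opDeriv δ hRi₀]; omega⟩ (by
          rw [← hAspan, finrank_span_image_eq_card hA, ← show Submodule.span k (v '' B) = M (s + 1)
            from hspan, finrank_span_image_eq_card hB]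
          omega)
      have hG1 : G.natDegree = 1 := by
        refine (hkey G fun i hi => ?_).antisymm (hMpos s G hG hG0)
        have h4 : R i ∈ M s := hvM (x := (0, i)) ⟨s.zero_le, hi⟩
        rw [hMG] at h4
        obtain ⟨S, -, hS⟩ := h4
        rw [← hS]
        exact opComp_mem_span δ G S
      have hAJ : A.card = ℓ + s := by
        rw [← finrank_span_image_eq_card hA, hAspan, hMG, finrank_degreeLT_map_opComp δ hG0, hG1]
        omega
      refine hcon ⟨A, by omega, fun x hx => ⟨(hAT hx).2, ?_⟩, hA, ?_⟩
      · have := (hAT hx).1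
        omega
      · obtain ⟨u, rfl⟩ : ∃ u, ℓ = s + 2 + u := ⟨ℓ - (s + 2), by omega⟩
        rw [show s + 2 + u - 1 = s + 1 + u by omega]
        rw [hAJ] at hAsum ⊢
        nlinarith
  obtain ⟨B, -, hB, hspan, hcard, -⟩ := hstage ℓ
  have := hrank ℓ
  rw [← hspan, finrank_span_image_eq_card hB] at this
  omega

theorem coeff_opDeriv_derivative_eq_zero {F : Type*} [CommRing F] {T : F[X][X]} {w : ℕ}
    (hT : ∀ i j, j < i + w → (T.coeff j).coeff i = 0) {i j : ℕ} (hij : j < i + (w + 1)) :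
    ((opDeriv derivative' T).coeff j).coeff i = 0 := by
  have hd : ∀ j, j < i + (w + 1) → (derivative (T.coeff j)).coeff i = 0 := fun j hj => by
    rw [coeff_derivative, hT _ _ (by omega), zero_mul]
  rcases j with _ | j
  · rw [coeff_opDeriv_zero]
    exact hd 0 hij
  · rw [coeff_opDeriv_succ, coeff_add, hT i j (by omega), zero_add]
    exact hd _ hij

theorem coeff_iterate_opDeriv_derivative_eq_zero {F : Type*} [CommRing F] {T : F[X][X]} {w : ℕ}
    (hT : ∀ i j, j < i + w → (T.coeff j).coeff i = 0) (a : ℕ) {i j : ℕ} (hij : j < i + (a + w)) :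
    (((opDeriv derivative')^[a] T).coeff j).coeff i = 0 := by
  induction a generalizing i j with
  | zero => exact hT i j (by omega)
  | succ a ih =>
    rw [Function.iterate_succ_apply']
    exact coeff_opDeriv_derivative_eq_zero (w := a + w) (fun i j h => ih h) (by omega)

theorem dvd_of_forall_dvd_mul_iterate_derivative {F : Type*} [Field F] [IsAlgClosed F] [CharZero F]
    {f q : F[X]} (hf : f ≠ 0) (hq : q ≠ 0)
    (h : ∀ c, f.IsRoot c → f ∣ q * derivative^[f.rootMultiplicity c] f) : f ∣ q := by
  classical
  refine (IsAlgClosed.splits f).dvd_of_roots_le_roots hf (Multiset.le_iff_count.mpr fun c => ?_)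
  rw [count_roots, count_roots]
  by_cases hc : f.IsRoot c
  swap
  · rw [rootMultiplicity_eq_zero hc]
    exact Nat.zero_le _
  have hnr : ¬ (derivative^[f.rootMultiplicity c] f).IsRoot c := by
    intro hr
    refine lt_irrefl (f.rootMultiplicity c)
      ((lt_rootMultiplicity_iff_isRoot_iterate_derivative hf).mpr fun m hm => ?_)
    rcases hm.lt_or_eq with hm | rfl
    · exact isRoot_iterate_derivative_of_lt_rootMultiplicity hm
    · exact hr
  have hd0 : derivative^[f.rootMultiplicity c] f ≠ 0 := by
    intro h0
    rw [h0] at hnr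
    exact hnr (by simp)
  have h1 := rootMultiplicity_le_rootMultiplicity_of_dvd (mul_ne_zero hq hd0) (h c hc) c
  rwa [rootMultiplicity_mul (mul_ne_zero hq hd0), rootMultiplicity_eq_zero hnr, add_zero] at h1

theorem natDegree_det_add_sum_le {F : Type*} [CommRing F] {J : ℕ}
    {N : Matrix (Fin J) (Fin J) F[X]} {w : Fin J → ℕ} (hN : N.det ≠ 0)
    (h : ∀ (b j : Fin J) (i : ℕ), (j : ℕ) + 1 < i + w b → (N b j).coeff i = 0) :
    N.det.natDegree + ∑ b, w b ≤ ∑ j : Fin J, ((j : ℕ) + 1) := by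
  classical
  let P : F[X] → Prop := fun p => p = 0 ∨ p.natDegree + ∑ b, w b ≤ ∑ j : Fin J, ((j : ℕ) + 1)
  have hP : P N.det := by
    rw [Matrix.det_apply]
    refine Finset.sum_induction _ P ?_ (Or.inl rfl) fun σ _ => ?_
    · rintro p q (rfl | hp) (rfl | hq)
      · exact Or.inl (add_zero _)
      · rw [zero_add]
        exact Or.inr hq
      · rw [add_zero]
        exact Or.inr hp
      · right
        rcases le_total p.natDegree q.natDegree with hpq | hpq
        · exact (Nat.add_le_add_right ((natDegree_add_le p q).trans (max_le hpq le_rfl)) _).trans hq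
        · exact (Nat.add_le_add_right ((natDegree_add_le p q).trans (max_le le_rfl hpq)) _).trans hp
    · by_cases h0 : ∃ j, N (σ j) j = 0
      · obtain ⟨j, hj⟩ := h0
        left
        have h1 : ∏ i, N (σ i) i = 0 := Finset.prod_eq_zero (Finset.mem_univ j) hj
        rw [h1, smul_zero]
      push Not at h0
      right
      have h1 : ∀ j, (N (σ j) j).natDegree + w (σ j) ≤ (j : ℕ) + 1 := fun j => by
        by_contra! hlt
        exact h0 j (leadingCoeff_eq_zero.mp (h _ _ _ hlt))
      have h2 : ∑ b, w b = ∑ j, w (σ j) := (Equiv.sum_comp σ w).symm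
      calc _ ≤ ∑ j, (N (σ j) j).natDegree + ∑ j, w (σ j) := by
            rw [h2]
            refine Nat.add_le_add_right ?_ _
            refine le_trans ?_ (natDegree_prod_le _ _)
            rw [Units.smul_def]
            exact natDegree_smul_le _ _
        _ ≤ _ := by
          rw [← Finset.sum_add_distrib]
          exact Finset.sum_le_sum fun j _ => h1 j
  exact hP.resolve_left hN

theorem natDegree_add_sum_le_of_linearIndependent {F : Type*} [Field F] [IsAlgClosed F] [CharZero F]
    {f : F[X]} (hf : f ≠ 0) {J : ℕ} {T : Fin J → F[X][X]} {w : Fin J → ℕ}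
    (hT : LinearIndependent F[X] T) (hdeg : ∀ b, (T b).natDegree ≤ J)
    (hann : ∀ b, opEval derivative' (T b) f = 0) (hroot : ∀ c, f.rootMultiplicity c ≤ J)
    (hw : ∀ b i j, j < i + w b → ((T b).coeff j).coeff i = 0) :
    2 * (f.natDegree + ∑ b, w b) ≤ J * (J + 1) := by
  have hsum : ∀ S : F[X][X], S.natDegree ≤ J → opEval derivative' S f =
      S.coeff 0 * f + ∑ j : Fin J, S.coeff (j + 1) * derivative^[j + 1] f := by
    intro S hS
    rw [opEval_apply, sum_over_range' _ _ (J + 1) (by omega), Finset.sum_range_succ']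
    · rw [Finset.sum_range, add_comm]
      rfl
    · simp
  set N : Matrix (Fin J) (Fin J) F[X] := Matrix.of fun b j => (T b).coeff (j + 1) with hN
  have hdet : N.det ≠ 0 := by
    intro h0
    obtain ⟨v, hv0, hv⟩ := Matrix.exists_vecMul_eq_zero_iff.mpr h0
    set S : F[X][X] := ∑ b, v b • T b with hS
    have hSdeg : S.natDegree ≤ J :=
      natDegree_sum_le_of_forall_le _ _ fun b _ => (natDegree_smul_le _ _).trans (hdeg b)
    have hSann : opEval derivative' S f = 0 := by
      rw [hS, map_sum, LinearMap.sum_apply]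
      refine Finset.sum_eq_zero fun b _ => ?_
      rw [map_smul, LinearMap.smul_apply, hann, smul_zero]
    have hScoeff : ∀ j : Fin J, S.coeff (j + 1) = 0 := fun j => by
      have := congrFun hv j
      rw [hS, finsetSum_coeff]
      simpa [Matrix.vecMul, dotProduct, hN] using this
    have hS0 : S.coeff 0 = 0 := by
      rw [hsum S hSdeg, Finset.sum_eq_zero fun j _ => by rw [hScoeff, zero_mul], add_zero] at hSann
      exact (mul_eq_zero.mp hSann).resolve_right hf
    have hSz : S = 0 := by
      ext1 j
      rw [coeff_zero]
      rcases j with _ | j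
      · exact hS0
      by_cases hj : j < J
      · exact hScoeff ⟨j, hj⟩
      · exact coeff_eq_zero_of_natDegree_lt (by omega)
    exact hv0 (funext (Fintype.linearIndependent_iff.mp hT v hSz))
  have hdvd : f ∣ N.det := by
    refine dvd_of_forall_dvd_mul_iterate_derivative hf hdet fun c hc => ?_
    obtain ⟨m, hm⟩ : ∃ m, f.rootMultiplicity c = m + 1 :=
      Nat.exists_eq_add_one.mpr ((rootMultiplicity_pos hf).mpr hc)
    have hmJ : m < J := by
      have := hroot c
      omega
    set u : Fin J → F[X] := fun j => derivative^[j + 1] f with hu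
    have h1 : N.mulVec u = f • fun b => -(T b).coeff 0 := by
      ext1 b
      have := hann b
      rw [hsum _ (hdeg b), add_comm, ← eq_neg_iff_add_eq_zero] at this
      rw [Pi.smul_apply, smul_eq_mul, mul_neg, mul_comm f, ← this]
      rfl
    have h2 := congrArg (N.adjugate.mulVec) h1
    rw [Matrix.mulVec_mulVec, Matrix.adjugate_mul, Matrix.mulVec_smul, Matrix.smul_mulVec,
      Matrix.one_mulVec] at h2
    have h3 := congrFun h2 ⟨m, hmJ⟩
    rw [hm]
    exact ⟨_, h3⟩
  have h1 := natDegree_le_of_dvd hdvd hdet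
  have h2 := natDegree_det_add_sum_le (w := w) hdet fun b j i h => hw b i _ h
  have h3 : (∑ j : Fin J, ((j : ℕ) + 1)) * 2 = J * (J + 1) := by
    have := Finset.sum_range_id_mul_two (J + 1)
    rw [Finset.sum_range_succ', add_zero, Finset.sum_range, Nat.add_sub_cancel, mul_comm (J + 1)] at this
    exact this
  omega

theorem natDegree_le_of_not_pow_add_C {F : Type*} [Field F] [IsAlgClosed F] [CharZero F]
    {f g : F[X]} (hf : 0 < f.natDegree) (hg : 0 < g.natDegree)
    (hpow : ¬ ∃ (m : ℕ) (k : F[X]) (c : F), 2 ≤ m ∧ g = k ^ m + C c)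
    (hmin : ∀ s : F[X], s ≠ 0 → s.natDegree < f.natDegree →
      ¬ (s.comp g).support ⊆ (f.comp g).support)
    (hcard : 2 ≤ (f.comp g).support.card)
    (hroot : ∀ c, f.rootMultiplicity c ≤ (f.comp g).support.card) :
    f.natDegree ≤ (f.comp g).support.card * ((f.comp g).support.card - 1) := by
  have hf0 : f ≠ 0 := ne_zero_of_natDegree_gt hf
  let k := FractionRing F[X]
  have : Algebra.FormallyEtale F[X] k := Algebra.FormallyEtale.of_isLocalization (nonZeroDivisors F[X])
  obtain ⟨δ, hδ⟩ := exists_derivation_extension (R := F) (T := k) (derivative' (R := F))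
  have hinj : Function.Injective (algebraMap F[X] k) := IsFractionRing.injective F[X] k
  obtain ⟨R, hRdeg, hR, hRw⟩ := exists_annihilating_rows hg (f.comp g).support.toList
  set ℓ := (f.comp g).support.card with hℓ
  rw [Finset.length_toList] at hRdeg
  have hRann : ∀ i < g.natDegree, opEval derivative' (R i) f = 0 := fun i hi =>
    opEval_row_eq_zero hR (opEvalComp_eulerAnnihilator_eq_zero g fun e he => Finset.mem_toList.mpr he) hi
  set v : ℕ × ℕ → k[X] := fun x => (opDeriv δ)^[x.1] ((R x.2).map (algebraMap F[X] k)) with hv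
  set T : ℕ × ℕ → F[X][X] := fun x => (opDeriv derivative')^[x.1] (R x.2) with hT
  have hTv : ∀ x, (T x).map (algebraMap F[X] k) = v x := fun x => map_iterate_opDeriv hδ _ _
  have hTann : ∀ x : ℕ × ℕ, x.2 < g.natDegree → opEval derivative' (T x) f = 0 := fun x hx => by
    rw [hT, opEval_iterate_opDeriv, hRann _ hx]
    exact Function.iterate_fixed (map_zero _) _
  have htop : ∃ i < g.natDegree, ((R i).map (algebraMap F[X] k)).natDegree = ℓ := by
    by_contra! hne
    have h1 := hR ℓ
    rw [hℓ, ← Finset.length_toList, coeff_eulerAnnihilator_length, Finset.length_toList, ← hℓ,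
      Finset.sum_eq_zero] at h1
    · refine pow_ne_zero _ (mul_ne_zero X_ne_zero ?_) h1
      intro h
      exact hg.ne' (derivative_eq_zero.mp h)
    · intro i hi
      have h2 := hne i (Finset.mem_range.mp hi)
      rw [natDegree_map_eq_of_injective hinj] at h2
      rw [coeff_eq_zero_of_natDegree_lt ((hRdeg i).lt_of_ne h2), zero_comp, zero_mul]
  have hconst : ∀ c : k, c ≠ 0 → C c ∉ Submodule.span k (v '' {x | x.2 < g.natDegree}) := by
    intro c hc hmem
    have hle : Submodule.span k (v '' {x | x.2 < g.natDegree}) ≤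
        LinearMap.ker ((opEval δ).flip (algebraMap F[X] k f)) := by
      refine Submodule.span_le.mpr ?_
      rintro _ ⟨x, hx, rfl⟩
      rw [SetLike.mem_coe, LinearMap.mem_ker, LinearMap.flip_apply, ← hTv, opEval_map hδ,
        hTann x hx, map_zero]
    have h1 := hle hmem
    rw [LinearMap.mem_ker, LinearMap.flip_apply, opEval_C] at h1
    exact mul_ne_zero hc ((map_ne_zero_iff _ hinj).mpr hf0) h1
  obtain ⟨B, hℓB, hBmem, hB, hBsum⟩ := exists_independent_rows δ
    (R := fun i => (R i).map (algebraMap F[X] k)) (n := g.natDegree) hcard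
    (fun i _ => natDegree_map_le.trans (hRdeg i)) htop hconst
    (fun G hG => natDegree_le_one_of_rows_mem_span hf hg hpow hmin hδ hR hG)
  set w : ℕ × ℕ → ℕ := fun x => x.1 + if x.2 = 0 then 0 else 1 with hw
  have hTw : ∀ x i j, j < i + w x → ((T x).coeff j).coeff i = 0 := fun x i j h => by
    refine coeff_iterate_opDeriv_derivative_eq_zero (fun i j hij => hRw _ _ _ ?_) x.1 h
    split_ifs at hij with hx
    · rw [hx, add_zero]
      exact Nat.mul_lt_mul_of_pos_left hij hg
    · have := Nat.mul_le_mul_left g.natDegree (Nat.lt_succ_iff.mp hij)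
      omega
  let e : Fin B.card ≃ B := B.equivFin.symm
  have hli : LinearIndependent F[X] fun b => T (e b) := by
    have h1 : LinearIndependent k fun b : Fin B.card => v (e b) := hB.comp e e.injective
    rw [Fintype.linearIndependent_iff] at h1 ⊢
    intro c hc b
    refine hinj ?_
    rw [map_zero]
    refine h1 (fun b => algebraMap F[X] k (c b)) ?_ b
    have h2 := congrArg (Polynomial.map (algebraMap F[X] k)) hc
    rw [Polynomial.map_sum, Polynomial.map_zero] at h2
    rw [← h2]
    refine Finset.sum_congr rfl fun b _ => ?_
    rw [smul_eq_C_mul, smul_eq_C_mul, Polynomial.map_mul, map_C, hTv]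
  have hmain := natDegree_add_sum_le_of_linearIndependent hf0 hli (w := fun b => w (e b))
    (fun b => ?_) (fun b => hTann _ (hBmem _ (e b).2).1) (fun c => (hroot c).trans hℓB)
    (fun b => hTw _)
  · have h1 : ∑ b, w (e b) = ∑ x ∈ B, w x := by
      rw [e.sum_comp fun x => w x, Finset.sum_coe_sort]
    replace hmain : 2 * (f.natDegree + ∑ x ∈ B, w x) ≤ B.card * (B.card + 1) := h1 ▸ hmain
    replace hBsum : B.card * (B.card + 1) ≤ 2 * ∑ x ∈ B, w x + 2 * (ℓ * (ℓ - 1)) := hBsum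
    omega
  · refine (natDegree_iterate_opDeriv_le _ _ _).trans (le_trans ?_ (hBmem _ (e b).2).2)
    exact Nat.add_le_add_right (hRdeg _) _

theorem exists_minimal_support_comp {F : Type*} [Field F] {f g : F[X]} (hg : 0 < g.natDegree) :
    ∃ f' : F[X], f'.natDegree = f.natDegree ∧
      (f'.comp g).support.card ≤ (f.comp g).support.card ∧
      ∀ s : F[X], s ≠ 0 → s.natDegree < f'.natDegree →
        ¬ (s.comp g).support ⊆ (f'.comp g).support := by
  induction hN : (f.comp g).support.card using Nat.strong_induction_on generalizing f with
  | _ N ih =>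
    subst hN
    by_contra! hcon
    obtain ⟨s, hs0, hs, hsupp⟩ := hcon f rfl le_rfl
    obtain ⟨e, he⟩ := support_nonempty.mpr (comp_ne_zero_of_natDegree_pos hs0 hg)
    set a := (f.comp g).coeff e / (s.comp g).coeff e with ha
    have hdeg : (f - C a * s).natDegree = f.natDegree :=
      natDegree_sub_eq_left_of_natDegree_lt ((natDegree_C_mul_le a s).trans_lt hs)
    have hlt : ((f - C a * s).comp g).support.card < (f.comp g).support.card := by
      refine Finset.card_lt_card ((Finset.ssubset_iff_of_subset fun i hi => ?_).mpr
        ⟨e, hsupp he, ?_⟩)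
      · by_contra hif
        have his : i ∉ (s.comp g).support := fun h => hif (hsupp h)
        rw [notMem_support_iff] at hif his
        rw [mem_support_iff, sub_comp, mul_comp, C_comp, coeff_sub, coeff_C_mul, hif, his] at hi
        simp at hi
      · rw [notMem_support_iff, sub_comp, mul_comp, C_comp, coeff_sub, coeff_C_mul, ha,
          div_mul_cancel₀ _ (mem_support_iff.mp he), sub_self]
    obtain ⟨f', h1, h2, h3⟩ := ih _ hlt rfl
    obtain ⟨s', hs'0, hs', hsupp'⟩ := hcon f' (h1.trans hdeg) (h2.trans hlt.le)
    exact h3 s' hs'0 hs' hsupp'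

theorem natDegree_le_card_support_comp {f g : ℂ[X]}
    (hg : ¬ ∃ (a b : ℂ) (n : ℕ), g = C a * X ^ n + C b) :
    f.natDegree ≤ (f.comp g).support.card * ((f.comp g).support.card - 1) := by
  induction hn : g.natDegree using Nat.strong_induction_on generalizing f g with
  | _ n ih =>
    subst hn
    have hg0 : 0 < g.natDegree := by
      rw [Nat.pos_iff_ne_zero]
      intro h
      obtain ⟨b, rfl⟩ := natDegree_eq_zero.mp h
      exact hg ⟨0, b, 0, by simp⟩
    by_cases hpow : ∃ (m : ℕ) (k : ℂ[X]) (c : ℂ), 2 ≤ m ∧ g = k ^ m + C c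
    · obtain ⟨m, h, c, hm, rfl⟩ := hpow
      rw [natDegree_add_C, natDegree_pow] at hg0
      by_cases hh : ∃ (a b : ℂ) (n : ℕ), h = C a * X ^ n + C b
      · obtain ⟨a, b, k, rfl⟩ := hh
        refine natDegree_le_of_comp_pow_of_monomial_add_C ?_ ?_ ?_ hm
        · rintro rfl
          simp at hg0
        · rintro rfl
          refine hg ⟨a ^ m, c, k * m, ?_⟩
          rw [C_0, add_zero, mul_pow, ← C_pow, ← pow_mul]
        · rw [Nat.pos_iff_ne_zero]
          rintro rfl
          rw [pow_zero, mul_one, ← C_add, natDegree_C, mul_zero] at hg0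
          exact hg0.false
      · have hlt : h.natDegree < (h ^ m + C c).natDegree := by
          rw [natDegree_add_C, natDegree_pow]
          have := Nat.pos_of_mul_pos_left hg0
          nlinarith
        have h1 := ih _ hlt (f := f.comp (X ^ m + C c)) hh rfl
        rw [natDegree_comp, natDegree_add_C, natDegree_X_pow, comp_assoc, add_comp, X_pow_comp,
          C_comp] at h1
        exact (Nat.le_mul_of_pos_right _ (by omega)).trans h1
    · rcases Nat.eq_zero_or_pos f.natDegree with hf | hf
      · omega
      obtain ⟨f', hdeg, hcard, hmin⟩ := exists_minimal_support_comp (f := f) hg0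
      rw [← hdeg] at hf ⊢
      have hf0 : f' ≠ 0 := ne_zero_of_natDegree_gt hf
      have hroot := rootMultiplicity_lt_card_support_comp hg
        (comp_ne_zero_of_natDegree_pos hf0 hg0)
      obtain ⟨c, hc⟩ := IsAlgClosed.exists_root f' (natDegree_pos_iff_degree_pos.mp hf).ne'
      have h2 := (rootMultiplicity_pos hf0).mpr hc
      refine (natDegree_le_of_not_pow_add_C hf hg0 hpow hmin ?_ fun c => (hroot c).le).trans
        (Nat.mul_le_mul hcard (Nat.sub_le_sub_right hcard 1))
      have := hroot c
      omega

/-- Zannier (2007): if `f(g(x))` has at most `ℓ` terms, then either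
`g(x) = a·x^n + b`, or `deg f ≤ ℓ(ℓ-1)`. -/
theorem zannier_uniformity (ℓ : ℕ) (hℓ : 1 ≤ ℓ) (f g : Polynomial ℂ)
    (h : (f.comp g).support.card ≤ ℓ) :
    (∃ (a b : ℂ) (n : ℕ), g = Polynomial.C a * Polynomial.X ^ n + Polynomial.C b) ∨
    f.natDegree ≤ ℓ * (ℓ - 1) :=
  or_iff_not_imp_left.mpr fun hg => (natDegree_le_card_support_comp hg).trans
    (Nat.mul_le_mul h (Nat.sub_le_sub_right h 1))
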